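/- arXiv:2001.07642 — 3 statements merged into one kernel-verified Lean document; each statement's English description precedes it below -/
import Mathlib

section
/- Let G ⊆ K_{n,n} be an elementary graph. Then the Fourier coefficient of BPM_n (as a function into {−1,1}) indexed by the edge set of G equals 2^{−n²+1}. -/
open Finset
open scoped Classical

/-- Edges of the complete bipartite graph `K_{n,n}` on labeled parts of size `n`. -/
abbrev Edge (n : ℕ) := Fin n × Fin n

/-- `M` is (the edge set of) a perfect matching of `K_{n,n}`. -/
def isPM {n : ℕ} (M : Finset (Edge n)) : Prop :=
  ∃ σ : Equiv.Perm (Fin n), M = Finset.univ.image fun i => (i, σ i)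

/-- `G` is matching-covered: its edge set is a (nonempty) union of perfect matchings. -/
def matchingCovered {n : ℕ} (G : Finset (Edge n)) : Prop :=
  ∃ S : Finset (Finset (Edge n)), S.Nonempty ∧ (∀ M ∈ S, isPM M) ∧ S.sup id = G

/-- `G` contains a perfect matching. -/
def hasPM {n : ℕ} (G : Finset (Edge n)) : Prop :=
  ∃ σ : Equiv.Perm (Fin n), ∀ i, (i, σ i) ∈ G

/-- The bipartite graph on the vertex set `Fin n ⊕ Fin n` with edge set `G`. -/
def graphOn {n : ℕ} (G : Finset (Edge n)) : SimpleGraph (Fin n ⊕ Fin n) :=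
  SimpleGraph.fromRel fun u v => ∃ e ∈ G, u = Sum.inl e.1 ∧ v = Sum.inr e.2

/-- The number of connected components of `G` (as a spanning subgraph of `K_{n,n}`). -/
noncomputable def numComponents {n : ℕ} (G : Finset (Edge n)) : ℕ :=
  Nat.card (graphOn G).ConnectedComponent

/-- The cyclomatic number `χ(G) = |E(G)| − |V(G)| + |C(G)|`. -/
noncomputable def cyclo {n : ℕ} (G : Finset (Edge n)) : ℤ :=
  (G.card : ℤ) + numComponents G - 2 * n

/-- `G` is elementary: a connected matching-covered graph. -/
def elementary {n : ℕ} (G : Finset (Edge n)) : Prop :=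
  matchingCovered G ∧ (graphOn G).Connected

/-- The bipartite perfect matching decision function, on inputs `x : Edge n → Bool`. -/
def BPMb (n : ℕ) (x : Edge n → Bool) : Prop :=
  ∃ σ : Equiv.Perm (Fin n), ∀ i, x (i, σ i) = true

/-- The common kernel of the functionals `l e` with `e ∈ B`. -/
def commonKer {ι V : Type*} [AddCommGroup V] [Module ℝ V] (l : ι → V →ₗ[ℝ] ℝ) (B : Set ι) :
    Submodule ℝ V :=
  ⨅ e ∈ B, LinearMap.ker (l e)

theorem mem_commonKer {ι V : Type*} [AddCommGroup V] [Module ℝ V] {l : ι → V →ₗ[ℝ] ℝ}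
    {B : Set ι} {w : V} : w ∈ commonKer l B ↔ ∀ e ∈ B, l e w = 0 := by
  simp [commonKer]

theorem finrank_commonKer_insert {ι V : Type*} [AddCommGroup V] [Module ℝ V]
    [FiniteDimensional ℝ V] {l : ι → V →ₗ[ℝ] ℝ} {B : Set ι} {f : ι} {w : V}
    (hw : w ∈ commonKer l B) (hf : l f w ≠ 0) :
    Module.finrank ℝ (commonKer l (insert f B)) + 1 = Module.finrank ℝ (commonKer l B) := by
  have h1 := LinearMap.finrank_range_add_finrank_ker ((l f).domRestrict (commonKer l B))
  have h2 : LinearMap.range ((l f).domRestrict (commonKer l B)) = ⊤ := by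
    rw [LinearMap.range_eq_top]
    intro c
    refine ⟨(c / l f w) • ⟨w, hw⟩, ?_⟩
    simp [hf]
  have h3 : (LinearMap.ker ((l f).domRestrict (commonKer l B))).map (commonKer l B).subtype
      = commonKer l (insert f B) := by
    ext v
    simp [mem_commonKer, and_comm]
  have h4 := (Submodule.equivMapOfInjective _ (commonKer l B).injective_subtype
    (LinearMap.ker ((l f).domRestrict (commonKer l B)))).finrank_eq
  rw [h3] at h4
  rw [h2, finrank_top, Module.finrank_self] at h1
  omega

theorem eventually_sign_add_mul (a b : ℝ) (h : a = 0 → b = 0) :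
    ∀ᶠ ε in nhds (0 : ℝ), SignType.sign (a + ε * b) = SignType.sign a := by
  have hc : Filter.Tendsto (fun ε : ℝ => a + ε * b) (nhds 0) (nhds a) := by
    have : Continuous fun ε : ℝ => a + ε * b := by fun_prop
    simpa using this.tendsto 0
  rcases lt_trichotomy a 0 with ha | ha | ha
  · filter_upwards [hc.eventually_lt_const ha] with ε hε
    rw [sign_neg hε, sign_neg ha]
  · simp [ha, h ha]
  · filter_upwards [hc.eventually_const_lt ha] with ε hε
    rw [sign_pos hε, sign_pos ha]

theorem exists_pos_sign_eq {ι V : Type*} [AddCommGroup V] [Module ℝ V] (l : ι → V →ₗ[ℝ] ℝ)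
    (A : Finset ι) (z w : V) (h : ∀ e ∈ A, l e z = 0 → l e w = 0) :
    ∃ ε : ℝ, 0 < ε ∧ ∀ e ∈ A, SignType.sign (l e (z + ε • w)) = SignType.sign (l e z) ∧
      SignType.sign (l e (z - ε • w)) = SignType.sign (l e z) := by
  have h1 : ∀ᶠ ε in nhds (0 : ℝ), ∀ e ∈ A,
      SignType.sign (l e z + ε * l e w) = SignType.sign (l e z) :=
    (Filter.eventually_all_finset A).2 fun e he => eventually_sign_add_mul _ _ (h e he)
  obtain ⟨δ, hδ, hδ'⟩ := Metric.eventually_nhds_iff.1 h1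
  refine ⟨δ / 2, by positivity, fun e he => ⟨?_, ?_⟩⟩
  · have := hδ' (y := δ / 2) (by simp [abs_of_pos hδ]; linarith) e he
    simpa using this
  · have := hδ' (y := -(δ / 2)) (by simp [abs_of_pos hδ]; linarith) e he
    simpa [sub_eq_add_neg] using this

/-- If two vectors agree in sign on `A` but not at `f`, then `l f` has a zero in their sign cell. -/
theorem exists_sign_eq_of_sign_ne {ι V : Type*} [AddCommGroup V] [Module ℝ V]
    (l : ι → V →ₗ[ℝ] ℝ) (A : Finset ι) (f : ι) (z z' : V)
    (h : ∀ e ∈ A, SignType.sign (l e z') = SignType.sign (l e z))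
    (hf : SignType.sign (l f z') ≠ SignType.sign (l f z)) :
    ∃ y, l f y = 0 ∧ ∀ e ∈ A, SignType.sign (l e y) = SignType.sign (l e z) := by
  have key : ∀ t u : ℝ, 0 < t → 0 < u → ∀ e ∈ A,
      SignType.sign (l e (t • z + u • z')) = SignType.sign (l e z) := by
    intro t u ht hu e he
    have h' := h e he
    simp only [map_add, map_smul, smul_eq_mul]
    rcases lt_trichotomy (l e z) 0 with ha | ha | ha
    · rw [sign_neg ha] at h' ⊢
      rw [sign_eq_neg_one_iff] at h' ⊢
      nlinarith
    · rw [ha, sign_zero, sign_eq_zero_iff] at h'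
      simp [ha, h']
    · rw [sign_pos ha] at h' ⊢
      rw [sign_eq_one_iff] at h' ⊢
      positivity
  rcases lt_trichotomy (l f z) 0 with ha | ha | ha
  · rcases lt_trichotomy (l f z') 0 with hb | hb | hb
    · simp [sign_neg ha, sign_neg hb] at hf
    · exact ⟨z', hb, h⟩
    · refine ⟨l f z' • z + (-l f z) • z', by simp; ring, key _ _ hb (by linarith)⟩
  · exact ⟨z, ha, fun _ _ => rfl⟩
  · rcases lt_trichotomy (l f z') 0 with hb | hb | hb
    · refine ⟨(-l f z') • z + l f z • z', by simp; ring, key _ _ (by linarith) ha⟩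
    · exact ⟨z', hb, h⟩
    · simp [sign_pos ha, sign_pos hb] at hf

/-- The signed number of faces of the hyperplane arrangement `l` on which the functionals `l e`,
`e ∈ A`, have the same signs as at `z`. -/
noncomputable def faceSum {ι V : Type*} [Fintype ι] [DecidableEq ι] [AddCommGroup V] [Module ℝ V]
    (l : ι → V →ₗ[ℝ] ℝ) (A : Finset ι) (z : V) : ℝ :=
  ∑ s : ι → SignType, if (∃ y, ∀ e, SignType.sign (l e y) = s e) ∧
    ∀ e ∈ A, s e = SignType.sign (l e z)
    then (-1) ^ Module.finrank ℝ (commonKer l {e | s e = 0}) else 0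

/-- Euler relation: a relatively open cell cut out by some of the hyperplanes of an arrangement
has Euler characteristic `(-1) ^ dim`. -/
theorem faceSum_eq {ι V : Type*} [Fintype ι] [DecidableEq ι] [AddCommGroup V] [Module ℝ V]
    [FiniteDimensional ℝ V] (l : ι → V →ₗ[ℝ] ℝ) (A : Finset ι) (z : V) :
    faceSum l A z = (-1) ^ Module.finrank ℝ (commonKer l {e | e ∈ A ∧ l e z = 0}) := by
  induction hk : #Aᶜ generalizing A z with
  | zero =>
    have hA : A = univ := by simpa using hk
    subst hA
    rw [faceSum, Finset.sum_eq_single (fun e => SignType.sign (l e z))]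
    · rw [if_pos ⟨⟨z, fun _ => rfl⟩, fun _ _ => rfl⟩]
      have : {e | SignType.sign (l e z) = 0} = {e | e ∈ univ ∧ l e z = 0} := by
        ext e
        simp [sign_eq_zero_iff]
      rw [this]
    · intro s _ hs
      rw [if_neg]
      rintro ⟨-, h⟩
      exact hs (funext fun e => h e (mem_univ e))
    · simp
  | succ k ih =>
    obtain ⟨f, hfA⟩ : Aᶜ.Nonempty := card_pos.1 (by omega)
    have hf : f ∉ A := by simpa using hfA
    have ih' : ∀ y, faceSum l (insert f A) y =
        (-1) ^ Module.finrank ℝ (commonKer l {e | e ∈ insert f A ∧ l e y = 0}) := by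
      intro y
      apply ih
      rw [compl_insert, card_erase_of_mem hfA, hk]
      rfl
    have congr_zero : ∀ y, (∀ e ∈ A, SignType.sign (l e y) = SignType.sign (l e z)) →
        ∀ e ∈ A, (l e y = 0 ↔ l e z = 0) := by
      intro y hy e he
      rw [← sign_eq_zero_iff, hy e he, sign_eq_zero_iff]
    have set_zero : ∀ y, (∀ e ∈ A, SignType.sign (l e y) = SignType.sign (l e z)) →
        l f y = 0 → {e | e ∈ insert f A ∧ l e y = 0} = insert f {e | e ∈ A ∧ l e z = 0} := by
      intro y hy hfy
      ext e
      have := congr_zero y hy e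
      by_cases hef : e = f
      · simp [hef, hfy]
      · simp only [mem_insert, hef, false_or, Set.mem_ofPred_eq, Set.mem_insert_iff]
        tauto
    have set_ne : ∀ y, (∀ e ∈ A, SignType.sign (l e y) = SignType.sign (l e z)) →
        l f y ≠ 0 → {e | e ∈ insert f A ∧ l e y = 0} = {e | e ∈ A ∧ l e z = 0} := by
      intro y hy hfy
      ext e
      have := congr_zero y hy e
      by_cases hef : e = f
      · simp [hef, hfy, hf]
      · simp only [mem_insert, hef, false_or, Set.mem_ofPred_eq]
        tauto
    by_cases hex : ∃ y, l f y = 0 ∧ ∀ e ∈ A, SignType.sign (l e y) = SignType.sign (l e z)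
    · obtain ⟨y, hfy, hy⟩ := hex
      by_cases hw : ∃ w ∈ commonKer l {e | e ∈ A ∧ l e z = 0}, 0 < l f w
      · obtain ⟨w, hwW, hfw⟩ := hw
        obtain ⟨ε, hε, hs⟩ := exists_pos_sign_eq l A y w fun e he h0 =>
          mem_commonKer.1 hwW e ⟨he, (congr_zero y hy e he).1 h0⟩
        have hp : ∀ e ∈ A, SignType.sign (l e (y + ε • w)) = SignType.sign (l e z) :=
          fun e he => (hs e he).1.trans (hy e he)
        have hm : ∀ e ∈ A, SignType.sign (l e (y - ε • w)) = SignType.sign (l e z) :=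
          fun e he => (hs e he).2.trans (hy e he)
        have hpf : 0 < l f (y + ε • w) := by simp [hfy]; positivity
        have hmf : l f (y - ε • w) < 0 := by simp [hfy]; positivity
        have hsplit : faceSum l A z = faceSum l (insert f A) (y + ε • w) +
            faceSum l (insert f A) y + faceSum l (insert f A) (y - ε • w) := by
          simp only [faceSum, ← sum_add_distrib]
          refine sum_congr rfl fun s _ => ?_
          simp only [forall_mem_insert, sign_pos hpf, sign_neg hmf, hfy, sign_zero]
          have e1 : (∀ e ∈ A, s e = SignType.sign (l e (y + ε • w))) ↔
              ∀ e ∈ A, s e = SignType.sign (l e z) :=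
            forall₂_congr fun e he => by rw [hp e he]
          have e2 : (∀ e ∈ A, s e = SignType.sign (l e (y - ε • w))) ↔
              ∀ e ∈ A, s e = SignType.sign (l e z) :=
            forall₂_congr fun e he => by rw [hm e he]
          have e3 : (∀ e ∈ A, s e = SignType.sign (l e y)) ↔
              ∀ e ∈ A, s e = SignType.sign (l e z) :=
            forall₂_congr fun e he => by rw [hy e he]
          simp only [e1, e2, e3]
          rcases s f with _ | _ | _ <;> simp
        have hdim := finrank_commonKer_insert hwW hfw.ne'
        rw [hsplit, ih', ih', ih', set_ne _ hp hpf.ne', set_ne _ hm hmf.ne, set_zero y hy hfy,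
          ← hdim, pow_succ]
        ring
      · have hker : ∀ w ∈ commonKer l {e | e ∈ A ∧ l e z = 0}, l f w = 0 := by
          intro w hwW
          push Not at hw
          have h1 := hw w hwW
          have h2 := hw (-w) (neg_mem hwW)
          rw [map_neg] at h2
          linarith
        have hsum : faceSum l A z = faceSum l (insert f A) y := by
          refine sum_congr rfl fun s _ => if_congr ?_ rfl rfl
          refine and_congr_right ?_
          rintro ⟨x, hx⟩
          simp only [forall_mem_insert, hfy, sign_zero]
          have e3 : (∀ e ∈ A, s e = SignType.sign (l e y)) ↔
              ∀ e ∈ A, s e = SignType.sign (l e z) :=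
            forall₂_congr fun e he => by rw [hy e he]
          rw [e3, iff_and_self]
          intro h
          rw [← hx f, hker x, sign_zero]
          rw [mem_commonKer]
          rintro e ⟨he, hez⟩
          have := h e he
          rwa [hez, sign_zero, ← hx, sign_eq_zero_iff] at this
        have hspace : commonKer l (insert f {e | e ∈ A ∧ l e z = 0}) =
            commonKer l {e | e ∈ A ∧ l e z = 0} := by
          ext v
          rw [mem_commonKer, Set.forall_mem_insert, ← mem_commonKer]
          exact and_iff_right_of_imp (hker v)
        rw [hsum, ih', set_zero y hy hfy, hspace]
    · have hfz : l f z ≠ 0 := fun h => hex ⟨z, h, fun _ _ => rfl⟩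
      have hsum : faceSum l A z = faceSum l (insert f A) z := by
        refine sum_congr rfl fun s _ => if_congr ?_ rfl rfl
        refine and_congr_right ?_
        rintro ⟨x, hx⟩
        rw [forall_mem_insert, iff_and_self]
        intro h
        by_contra hne
        rw [← hx] at hne
        exact hex (exists_sign_eq_of_sign_ne l A f z x (fun e he => by rw [hx, h e he]) hne)
      rw [hsum, ih', set_ne z (fun _ _ => rfl) hfz]

theorem sum_bool_prod_of_le {ι : Type*} [Fintype ι] [DecidableEq ι] (G P : Finset ι) :
    ∑ x : ι → Bool, (if ∀ e, x e = true → e ∈ P then (1 : ℝ) else 0) *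
        ∏ e ∈ G, (if x e then (-1 : ℝ) else 1)
      = ∏ e, (1 + if e ∈ P then (if e ∈ G then (-1 : ℝ) else 1) else 0) := by
  have h := Finset.prod_univ_sum (fun _ : ι => (univ : Finset Bool)) (fun e b =>
    if b then (if e ∈ P then (if e ∈ G then (-1 : ℝ) else 1) else 0) else 1)
  simp only [Fintype.sum_bool, Fintype.piFinset_univ, if_true, Bool.false_eq_true, if_false] at h
  simp only [add_comm (1 : ℝ)]
  rw [h]
  refine sum_congr rfl fun x _ => ?_
  split_ifs with hx
  · rw [one_mul, ← prod_subset (subset_univ G)]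
    · refine prod_congr rfl fun e he => ?_
      by_cases hxe : x e = true <;> simp [hxe, he]
      exact hx e hxe
    · intro e _ he
      by_cases hxe : x e = true <;> simp [hxe, he]
      exact hx e hxe
  · push Not at hx
    obtain ⟨e, hxe, he⟩ := hx
    rw [zero_mul, eq_comm]
    exact prod_eq_zero (mem_univ e) (by simp [hxe, he])

/-- If no vector is nonpositive on all of `G` except those killed by every functional, then the
`G`-signed count of the sets on which the functionals can be made simultaneously positive
depends only on dimensions. -/
theorem sum_positive_sets {ι V : Type*} [Fintype ι] [DecidableEq ι] [AddCommGroup V] [Module ℝ V]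
    [FiniteDimensional ℝ V] (l : ι → V →ₗ[ℝ] ℝ) (G : Finset ι)
    (hG : ∀ z, (∀ e ∈ G, l e z ≤ 0) → ∀ e, l e z = 0) :
    ∑ x : ι → Bool, (if ∃ z, ∀ e, x e = true → 0 < l e z then (1 : ℝ) else 0) *
        ∏ e ∈ G, (if x e then (-1 : ℝ) else 1)
      = (-1) ^ Module.finrank ℝ V * (-1) ^ Module.finrank ℝ (commonKer l Set.univ) := by
  have h1 : ∀ x : ι → Bool, (if ∃ z, ∀ e, x e = true → 0 < l e z then (1 : ℝ) else 0) =
      (-1) ^ Module.finrank ℝ V * ∑ s : ι → SignType,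
        (if ∃ y, ∀ e, SignType.sign (l e y) = s e then
          (-1) ^ Module.finrank ℝ (commonKer l {e | s e = 0}) else 0) *
        (if ∀ e, x e = true → e ∈ univ.filter (fun e => s e = 1) then (1 : ℝ) else 0) := by
    intro x
    split_ifs with hx
    · obtain ⟨z, hz⟩ := hx
      have h := faceSum_eq l (univ.filter fun e => x e = true) z
      have hempty : {e | e ∈ univ.filter (fun e => x e = true) ∧ l e z = 0} = ∅ := by
        ext e
        simp only [mem_filter, mem_univ, true_and, Set.mem_ofPred_eq, Set.mem_empty_iff_false,
          iff_false, not_and]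
        exact fun he => (hz e he).ne'
      have htop : commonKer l ∅ = ⊤ := by simp [commonKer]
      rw [hempty, htop, finrank_top] at h
      have hsq : ((-1 : ℝ) ^ Module.finrank ℝ V) * (-1) ^ Module.finrank ℝ V = 1 := by
        rw [← mul_pow]; simp
      refine hsq.symm.trans (congrArg _ ?_)
      rw [← h, faceSum]
      refine sum_congr rfl fun s _ => ?_
      rw [ite_and, mul_ite, mul_one, mul_zero]
      have : (∀ e ∈ univ.filter (fun e => x e = true), s e = SignType.sign (l e z)) ↔
          ∀ e, x e = true → e ∈ univ.filter (fun e => s e = 1) := by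
        simp only [mem_filter, mem_univ, true_and]
        exact forall₂_congr fun e he => by rw [sign_pos (hz e he)]
      simp only [this]
      split_ifs <;> rfl
    · refine (mul_eq_zero_of_right _ (sum_eq_zero fun s _ => ?_)).symm
      by_cases hs : ∃ y, ∀ e, SignType.sign (l e y) = s e
      · obtain ⟨y, hy⟩ := hs
        rw [if_neg (c := ∀ e, x e = true → _), mul_zero]
        intro h
        refine hx ⟨y, fun e he => ?_⟩
        rw [← sign_eq_one_iff, hy e]
        simpa using h e he
      · rw [if_neg hs, zero_mul]
  simp only [h1, mul_assoc]
  rw [← mul_sum]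
  congr 1
  simp only [sum_mul]
  rw [sum_comm]
  simp only [mul_assoc, ← mul_sum, sum_bool_prod_of_le]
  rw [sum_eq_single (0 : ι → SignType)]
  · rw [if_pos ⟨0, by simp⟩]
    have : {e : ι | (0 : ι → SignType) e = 0} = Set.univ := by ext; simp
    rw [this]
    simp
  · intro s _ hs
    by_cases hc : ∃ y, ∀ e, SignType.sign (l e y) = s e
    · obtain ⟨y, hy⟩ := hc
      have : ∃ e ∈ G, 0 < l e y := by
        by_contra! hneg
        refine hs (funext fun e => ?_)
        rw [← hy, hG y hneg e, sign_zero]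
        rfl
      obtain ⟨e, heG, he⟩ := this
      rw [prod_eq_zero (mem_univ e), mul_zero]
      rw [if_pos, if_pos heG]
      · norm_num
      · simp [← hy e, sign_pos he]
    · rw [if_neg hc, zero_mul]
  · simp

/-- The functional on vertex potentials attached to an edge: the total potential difference minus
`n` times the potential difference along the edge. -/
noncomputable def edgeFunctional {n : ℕ} (e : Edge n) :
    ((Fin n → ℝ) × (Fin n → ℝ)) →ₗ[ℝ] ℝ where
  toFun z := (∑ i, z.1 i - ∑ j, z.2 j) - n * (z.1 e.1 - z.2 e.2)
  map_add' z w := by simp [sum_add_distrib]; ring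
  map_smul' c z := by simp [← mul_sum]; ring

theorem edgeFunctional_apply {n : ℕ} (e : Edge n) (z : (Fin n → ℝ) × (Fin n → ℝ)) :
    edgeFunctional e z = (∑ i, z.1 i - ∑ j, z.2 j) - n * (z.1 e.1 - z.2 e.2) :=
  rfl

theorem sum_edgeFunctional {n : ℕ} (σ : Equiv.Perm (Fin n)) (z : (Fin n → ℝ) × (Fin n → ℝ)) :
    ∑ i, edgeFunctional (i, σ i) z = 0 := by
  simp only [edgeFunctional_apply, sum_sub_distrib, ← mul_sum, Equiv.sum_comp σ z.2]
  simp
  ring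

theorem not_BPMb_iff {n : ℕ} (hn : 0 < n) (x : Edge n → Bool) :
    ¬ BPMb n x ↔ ∃ z, ∀ e, x e = true → 0 < edgeFunctional e z := by
  constructor
  · intro h
    have hall := (Fintype.all_card_le_filter_rel_iff_exists_injective
      (fun i j : Fin n => x (i, j) = true)).not.2 (by
        rintro ⟨f, hf, hx⟩
        exact h ⟨Equiv.ofBijective f (Finite.injective_iff_bijective.1 hf), hx⟩)
    push Not at hall
    obtain ⟨A, hA⟩ := hall
    refine ⟨(fun i => if i ∈ A then 1 else 0,
      fun j => if ∃ i ∈ A, x (i, j) = true then 1 else 0), ?_⟩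
    rintro ⟨i, j⟩ hij
    have hA' : ((#{b | ∃ a ∈ A, x (a, b) = true} : ℕ) : ℝ) < #A := by
      refine lt_of_eq_of_lt ?_ (Nat.cast_lt.2 hA)
      congr!
    have hle :
        (if i ∈ A then (1 : ℝ) else 0) - (if ∃ i ∈ A, x (i, j) = true then 1 else 0) ≤ 0 := by
      by_cases hi : i ∈ A
      · rw [if_pos hi, if_pos ⟨i, hi, hij⟩, sub_self]
      · rw [if_neg hi]
        split_ifs <;> norm_num
    rw [edgeFunctional_apply]
    have h1 : ∑ i, (if i ∈ A then (1 : ℝ) else 0) = #A := by simp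
    have h2 : ∑ j, (if ∃ i ∈ A, x (i, j) = true then (1 : ℝ) else 0) =
        #{b | ∃ a ∈ A, x (a, b) = true} := by
      rw [sum_boole]
    simp only [h1, h2]
    have := mul_nonpos_of_nonneg_of_nonpos (Nat.cast_nonneg (α := ℝ) n) hle
    linarith
  · rintro ⟨z, hz⟩ ⟨σ, hσ⟩
    have : Nonempty (Fin n) := ⟨⟨0, hn⟩⟩
    have hpos : 0 < ∑ i, edgeFunctional (i, σ i) z :=
      sum_pos (fun i _ => hz _ (hσ i)) univ_nonempty
    rw [sum_edgeFunctional] at hpos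
    exact hpos.false

theorem edgeFunctional_eq_zero_of_nonpos {n : ℕ} {G : Finset (Edge n)} (hG : matchingCovered G)
    (z : (Fin n → ℝ) × (Fin n → ℝ)) (hz : ∀ e ∈ G, edgeFunctional e z ≤ 0) :
    ∀ e ∈ G, edgeFunctional e z = 0 := by
  obtain ⟨S, -, hS, rfl⟩ := hG
  intro e he
  rw [mem_sup] at he
  obtain ⟨M, hM, heM⟩ := he
  obtain ⟨σ, rfl⟩ := hS M hM
  obtain ⟨i, -, rfl⟩ := mem_image.1 heM
  refine (sum_eq_zero_iff_of_nonpos fun i _ => hz _ ?_).1 (sum_edgeFunctional σ z) i (mem_univ i)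
  exact mem_sup.2 ⟨_, hM, mem_image_of_mem _ (mem_univ i)⟩

theorem edgeFunctional_eq_zero_of_connected {n : ℕ} (hn : 0 < n) {G : Finset (Edge n)}
    (hG : (graphOn G).Connected) (z : (Fin n → ℝ) × (Fin n → ℝ))
    (hz : ∀ e ∈ G, edgeFunctional e z = 0) (e : Edge n) : edgeFunctional e z = 0 := by
  have hn' : (n : ℝ) ≠ 0 := by positivity
  set c := ∑ i, z.1 i - ∑ j, z.2 j with hc
  let p : Fin n ⊕ Fin n → ℝ := Sum.elim (fun i => n * z.1 i - c) (fun j => n * z.2 j)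
  have hE : ∀ e ∈ G, p (Sum.inl e.1) = p (Sum.inr e.2) := by
    intro e he
    have := hz e he
    rw [edgeFunctional_apply, ← hc] at this
    simp only [p, Sum.elim_inl, Sum.elim_inr]
    linarith
  have hadj : ∀ u v, (graphOn G).Adj u v → p u = p v := by
    intro u v huv
    rw [graphOn, SimpleGraph.fromRel_adj] at huv
    obtain ⟨-, ⟨e, he, rfl, rfl⟩ | ⟨e, he, rfl, rfl⟩⟩ := huv
    · exact hE e he
    · exact (hE e he).symm
  have hconst : ∀ u v, p u = p v := by
    intro u v
    obtain ⟨w⟩ := hG.preconnected u v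
    induction w with
    | nil => rfl
    | cons h _ ih => exact (hadj _ _ h).trans ih
  have := hconst (Sum.inl e.1) (Sum.inr e.2)
  simp only [p, Sum.elim_inl, Sum.elim_inr] at this
  rw [edgeFunctional_apply, ← hc]
  linarith

theorem finrank_commonKer_edgeFunctional {n : ℕ} (hn : 0 < n) :
    Module.finrank ℝ (commonKer (edgeFunctional (n := n)) Set.univ) = 2 := by
  let i₀ : Fin n := ⟨0, hn⟩
  have hn' : (n : ℝ) ≠ 0 := by positivity
  let φ : (ℝ × ℝ) →ₗ[ℝ] ((Fin n → ℝ) × (Fin n → ℝ)) :=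
    { toFun := fun t => (fun _ => t.1, fun _ => t.2)
      map_add' := fun _ _ => rfl
      map_smul' := fun _ _ => rfl }
  have hφ : Function.Injective φ := by
    intro s t h
    exact Prod.ext (congrFun (congrArg Prod.fst h) i₀) (congrFun (congrArg Prod.snd h) i₀)
  have hrange : commonKer (edgeFunctional (n := n)) Set.univ = LinearMap.range φ := by
    ext z
    rw [mem_commonKer, LinearMap.mem_range]
    constructor
    · intro h
      have h' : ∀ i j, n * (z.1 i - z.2 j) = n * (z.1 i₀ - z.2 i₀) := by
        intro i j
        have h1 := h (i, j) trivial
        have h2 := h (i₀, i₀) trivial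
        rw [edgeFunctional_apply] at h1 h2
        simp only at h1 h2
        linarith
      have h'' : ∀ i j, z.1 i - z.2 j = z.1 i₀ - z.2 i₀ :=
        fun i j => mul_left_cancel₀ hn' (h' i j)
      refine ⟨(z.1 i₀, z.2 i₀), Prod.ext (funext fun i => ?_) (funext fun j => ?_)⟩
      · have := h'' i i₀
        change z.1 i₀ = z.1 i
        linarith
      · have := h'' i₀ j
        change z.2 i₀ = z.2 j
        linarith
    · rintro ⟨t, rfl⟩ e -
      simp [edgeFunctional_apply, φ]
      ring
  rw [hrange, LinearMap.finrank_range_of_inj hφ]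
  simp

theorem sum_bool_prod_eq_zero {ι : Type*} [Fintype ι] [DecidableEq ι] {G : Finset ι}
    (hG : G.Nonempty) :
    ∑ x : ι → Bool, ∏ e ∈ G, (if x e then (-1 : ℝ) else 1) = 0 := by
  obtain ⟨e, he⟩ := hG
  have h := sum_bool_prod_of_le G univ
  rw [prod_eq_zero (mem_univ e) (by simp [he])] at h
  simpa using h

theorem matchingCovered.nonempty {n : ℕ} (hn : 0 < n) {G : Finset (Edge n)}
    (hG : matchingCovered G) : G.Nonempty := by
  obtain ⟨S, ⟨M, hM⟩, hS, rfl⟩ := hG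
  obtain ⟨σ, rfl⟩ := hS M hM
  exact ⟨(⟨0, hn⟩, σ ⟨0, hn⟩), mem_sup.2 ⟨_, hM, mem_image_of_mem _ (mem_univ _)⟩⟩

/-- for an elementary graph `G ⊆ K_{n,n}`, the Fourier coefficient of `BPM_n`
(viewed as a `{−1,1}`-valued function via `0 ↦ 1`, `1 ↦ −1`) indexed by the edge set of `G`
equals `2^{−n²+1}`. -/
theorem stmt15 (n : ℕ) (G : Finset (Edge n)) (hG : elementary G) :
    (∑ x : Edge n → Bool,
        (if BPMb n x then (-1 : ℝ) else 1) * ∏ e ∈ G, (if x e then (-1 : ℝ) else 1))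
      / 2 ^ (n ^ 2)
      = (2 : ℝ) ^ (-(n ^ 2 : ℤ) + 1) := by
  have hn : 0 < n := by
    obtain ⟨v⟩ := hG.2.nonempty
    rcases v with i | i <;> exact i.pos
  have hsum := sum_positive_sets (edgeFunctional (n := n)) G fun z hz =>
    edgeFunctional_eq_zero_of_connected hn hG.2 z (edgeFunctional_eq_zero_of_nonpos hG.1 z hz)
  rw [finrank_commonKer_edgeFunctional hn, Module.finrank_prod, Module.finrank_fintype_fun_eq_card,
    ← two_mul, pow_mul] at hsum
  have hsplit : ∑ x : Edge n → Bool,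
      (if BPMb n x then (-1 : ℝ) else 1) * ∏ e ∈ G, (if x e then (-1 : ℝ) else 1) = 2 := by
    have hterm : ∀ x : Edge n → Bool, (if BPMb n x then (-1 : ℝ) else 1) =
        2 * (if ∃ z, ∀ e, x e = true → 0 < edgeFunctional e z then (1 : ℝ) else 0) - 1 := by
      intro x
      simp only [← not_BPMb_iff hn]
      split_ifs <;> norm_num
    simp only [hterm, sub_mul, sum_sub_distrib, one_mul, mul_assoc, ← mul_sum]
    rw [sum_bool_prod_eq_zero (hG.1.nonempty hn), hsum]
    norm_num
  rw [hsplit, zpow_add₀ two_ne_zero, zpow_neg, zpow_one, div_eq_inv_mul]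
  norm_cast
end

section
/- The probability that a uniformly random balanced bipartite graph on parts of size n (each edge present independently with probability 1/2) contains a perfect matching equals Σ_{G ∈ MC_n} (−1)^{χ(G)} / 2^{|E(G)|}. -/
open Finset
open scoped Classical

/-- Vectors of `W` vanishing outside `S`. -/
def supportedPart {E : Type*} (W : Submodule ℝ (E → ℝ)) (S : Finset E) :
    Submodule ℝ (E → ℝ) where
  carrier := {x | x ∈ W ∧ ∀ e ∉ S, x e = 0}
  add_mem' := fun {x y} hx hy =>
    ⟨W.add_mem hx.1 hy.1, fun e he => by simp [hx.2 e he, hy.2 e he]⟩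
  zero_mem' := ⟨W.zero_mem, fun _ _ => rfl⟩
  smul_mem' := fun c x hx => ⟨W.smul_mem c hx.1, fun e he => by simp [hx.2 e he]⟩

lemma mem_supportedPart {E : Type*} {W : Submodule ℝ (E → ℝ)} {S : Finset E} {x : E → ℝ} :
    x ∈ supportedPart W S ↔ x ∈ W ∧ ∀ e ∉ S, x e = 0 := Iff.rfl

/-- The points of `p + W` that are positive on `S` and vanish outside `S`. -/
def openCell {E : Type*} (W : Submodule ℝ (E → ℝ)) (p : E → ℝ) (S : Finset E) :
    Set (E → ℝ) :=
  {x | x - p ∈ W ∧ (∀ e ∈ S, 0 < x e) ∧ ∀ e ∉ S, x e = 0}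

lemma exists_gap (T : Finset ℝ) : ∃ ε > 0, ∀ s ∈ T, ∀ t ∈ T, s < t → s + ε < t := by
  have h : ∀ q ∈ T ×ˢ T, ∀ᶠ ε in nhdsWithin (0 : ℝ) (Set.Ioi 0), q.1 < q.2 → q.1 + ε < q.2 := by
    intro q _
    by_cases hq : q.1 < q.2
    · have : ∀ᶠ ε in nhdsWithin (0 : ℝ) (Set.Ioi 0), ε < q.2 - q.1 :=
        nhdsWithin_le_nhds (Iio_mem_nhds (by linarith))
      filter_upwards [this] with ε hε _
      linarith
    · exact Filter.Eventually.of_forall fun ε h => absurd h hq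
  obtain ⟨ε, h1, h2⟩ :=
    (((Finset.eventually_all _).2 h).and self_mem_nhdsWithin).exists
  exact ⟨ε, h2, fun s hs t ht => h1 (s, t) (Finset.mk_mem_product hs ht)⟩

lemma sum_jump_Icc {T : Finset ℝ} {ε a b : ℝ} (hε : 0 < ε)
    (hT : ∀ s ∈ T, ∀ t ∈ T, s < t → s + ε < t) (ha : a ∈ T) (hb : b ∈ T) (hab : a ≤ b) :
    ∑ t ∈ T, ((if t ∈ Set.Icc a b then (1 : ℝ) else 0) -
      if t + ε ∈ Set.Icc a b then 1 else 0) = 1 := by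
  rw [Finset.sum_eq_single_of_mem b hb]
  · rw [if_pos ⟨hab, le_rfl⟩, if_neg (fun h => by linarith [h.2]), sub_zero]
  · intro t ht htb
    simp only [Set.mem_Icc]
    rcases lt_or_gt_of_ne htb with h | h
    · have h1 := hT t ht b hb h
      rcases lt_or_ge t a with h2 | h2
      · have h3 := hT t ht a ha h2
        rw [if_neg (by rintro ⟨h, -⟩; linarith), if_neg (by rintro ⟨h, -⟩; linarith), sub_zero]
      · rw [if_pos ⟨h2, h.le⟩, if_pos ⟨by linarith, h1.le⟩, sub_self]
    · rw [if_neg (by rintro ⟨-, h⟩; linarith), if_neg (by rintro ⟨-, h⟩; linarith), sub_zero]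

lemma sum_jump_Ioo {T : Finset ℝ} {ε a b : ℝ} (hε : 0 < ε)
    (hT : ∀ s ∈ T, ∀ t ∈ T, s < t → s + ε < t) (ha : a ∈ T) (hb : b ∈ T) (hab : a < b) :
    ∑ t ∈ T, ((if t ∈ Set.Ioo a b then (1 : ℝ) else 0) -
      if t + ε ∈ Set.Ioo a b then 1 else 0) = -1 := by
  rw [Finset.sum_eq_single_of_mem a ha]
  · rw [if_neg (fun h => lt_irrefl _ h.1),
      if_pos ⟨by linarith, hT a ha b hb hab⟩, zero_sub]
  · intro t ht hta
    simp only [Set.mem_Ioo]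
    rcases lt_or_gt_of_ne hta with h | h
    · have h3 := hT t ht a ha h
      rw [if_neg (by rintro ⟨h, -⟩; linarith), if_neg (by rintro ⟨h, -⟩; linarith), sub_zero]
    · rcases lt_or_ge t b with h2 | h2
      · rw [if_pos ⟨h, h2⟩, if_pos ⟨by linarith, hT t ht b hb h2⟩, sub_self]
      · rw [if_neg (by rintro ⟨-, h⟩; linarith), if_neg (by rintro ⟨-, h⟩; linarith), sub_zero]

lemma sum_jump_eq_mul {P Q : ℝ → Prop} [DecidablePred P] [DecidablePred Q] {T : Finset ℝ}
    {ε c : ℝ} (h : ∀ t, P t ↔ Q t) :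
    ∑ t ∈ T, ((if P t then c else 0) - if P (t + ε) then c else 0) =
      c * ∑ t ∈ T, ((if Q t then (1 : ℝ) else 0) - if Q (t + ε) then 1 else 0) := by
  rw [Finset.mul_sum]
  refine Finset.sum_congr rfl fun t _ => ?_
  simp only [h]
  split_ifs <;> ring

lemma eq_Ioo_of_isOpen {s : Set ℝ} (ho : IsOpen s) (hc : s.OrdConnected) (hne : s.Nonempty)
    (hb : BddBelow s) (ha : BddAbove s) : ∃ a b, a < b ∧ s = Set.Ioo a b := by
  have h : s = Set.Ioo (sInf s) (sSup s) := by
    apply Set.Subset.antisymm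
    · intro x hx
      obtain ⟨l, u, ⟨hl, hu⟩, hlu⟩ := mem_nhds_iff_exists_Ioo_subset.1 (ho.mem_nhds hx)
      constructor
      · have : (l + x) / 2 ∈ s := hlu ⟨by linarith, by linarith⟩
        linarith [csInf_le hb this]
      · have : (x + u) / 2 ∈ s := hlu ⟨by linarith, by linarith⟩
        linarith [le_csSup ha this]
    · exact IsConnected.Ioo_csInf_csSup_subset ⟨hne, hc.isPreconnected⟩ hb ha
  obtain ⟨x, hx⟩ := hne
  refine ⟨_, _, ?_, h⟩
  rw [h] at hx
  exact hx.1.trans hx.2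

lemma finrank_inf_ker_add_one {V : Type*} [AddCommGroup V] [Module ℝ V] [FiniteDimensional ℝ V]
    (U : Submodule ℝ V) (f : V →ₗ[ℝ] ℝ) {w : V} (hw : w ∈ U) (hf : f w ≠ 0) :
    Module.finrank ℝ (U ⊓ LinearMap.ker f : Submodule ℝ V) + 1 = Module.finrank ℝ U := by
  have h := Module.Dual.finrank_ker_add_one_of_ne_zero (f := f.domRestrict U)
    (fun h => hf (by simpa using LinearMap.congr_fun h ⟨w, hw⟩))
  rw [← h, ← Submodule.finrank_map_subtype_eq, LinearMap.ker_domRestrict,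
    Submodule.map_comap_subtype]

/-- The vectors of `W` with vanishing coordinate `e`. -/
def coordSlice {E : Type*} (W : Submodule ℝ (E → ℝ)) (e : E) : Submodule ℝ (E → ℝ) :=
  W ⊓ LinearMap.ker (LinearMap.proj e : (E → ℝ) →ₗ[ℝ] ℝ)

lemma finrank_coordSlice_add_one {E : Type*} [Finite E] (W : Submodule ℝ (E → ℝ)) {w : E → ℝ}
    {e : E} (hw : w ∈ W) (he : w e ≠ 0) :
    Module.finrank ℝ (coordSlice W e) + 1 = Module.finrank ℝ W :=
  finrank_inf_ker_add_one W (LinearMap.proj e : (E → ℝ) →ₗ[ℝ] ℝ) hw he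

lemma supportedPart_coordSlice {E : Type*} (W : Submodule ℝ (E → ℝ)) (e : E) (S : Finset E) :
    supportedPart (coordSlice W e) S = coordSlice (supportedPart W S) e := by
  ext x
  simp only [coordSlice, mem_supportedPart, Submodule.mem_inf]
  tauto

lemma exists_openCell_coord_iff {E : Type*} {W : Submodule ℝ (E → ℝ)} {p q : E → ℝ} {e : E}
    (hq : q - p ∈ W) (S : Finset E) :
    (openCell (coordSlice W e) q S).Nonempty ↔ ∃ x ∈ openCell W p S, x e = q e := by
  have key : ∀ x, x - q ∈ coordSlice W e ↔ x - p ∈ W ∧ x e = q e := by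
    intro x
    simp only [coordSlice, Submodule.mem_inf, LinearMap.mem_ker, LinearMap.proj_apply,
      Pi.sub_apply, sub_eq_zero]
    have : x - p = (x - q) + (q - p) := by abel
    rw [this, W.add_mem_iff_left hq]
  simp only [Set.Nonempty, openCell, Set.mem_ofPred_eq, key]
  exact exists_congr fun x => by tauto

lemma add_smul_mem_openCell {E : Type*} [Finite E] {W : Submodule ℝ (E → ℝ)} {p x w : E → ℝ}
    {S : Finset E} (hx : x ∈ openCell W p S) (hw : w ∈ supportedPart W S) :
    ∀ᶠ δ in nhds (0 : ℝ), x + δ • w ∈ openCell W p S := by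
  have h : ∀ᶠ δ in nhds (0 : ℝ), ∀ e : E, e ∈ S → 0 < x e + δ * w e := by
    rw [Filter.eventually_all]
    intro e
    by_cases he : e ∈ S
    · have hc : Continuous fun δ : ℝ => x e + δ * w e := by fun_prop
      have h0 : 0 < x e + 0 * w e := by simpa using hx.2.1 e he
      filter_upwards [hc.continuousAt.eventually_const_lt h0] with δ hδ _ using hδ
    · exact Filter.Eventually.of_forall fun _ h => absurd h he
  filter_upwards [h] with δ hδ
  refine ⟨?_, fun e he => hδ e he, fun e he => ?_⟩
  · have : x + δ • w - p = (x - p) + δ • w := by abel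
    rw [this]
    exact W.add_mem hx.1 (W.smul_mem _ hw.1)
  · simp [hx.2.2 e he, hw.2 e he]

lemma openCell_nonneg {E : Type*} {W : Submodule ℝ (E → ℝ)} {p x : E → ℝ} {S : Finset E}
    (hx : x ∈ openCell W p S) : 0 ≤ x := fun e => by
  by_cases he : e ∈ S
  · exact (hx.2.1 e he).le
  · exact (hx.2.2 e he).ge

lemma convex_setOf_sub_mem {E : Type*} (W : Submodule ℝ (E → ℝ)) (p : E → ℝ) :
    Convex ℝ {x | x - p ∈ W} := by
  intro x hx y hy a b ha hb hab
  have : a • x + b • y - p = a • (x - p) + b • (y - p) := by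
    have hp : p = a • p + b • p := by rw [← add_smul, hab, one_smul]
    nth_rewrite 1 [hp]
    module
  change _ ∈ W
  rw [this]
  exact W.add_mem (W.smul_mem _ hx) (W.smul_mem _ hy)

lemma convex_openCell {E : Type*} (W : Submodule ℝ (E → ℝ)) (p : E → ℝ) (S : Finset E) :
    Convex ℝ (openCell W p S) := by
  intro x hx y hy a b ha hb hab
  refine ⟨convex_setOf_sub_mem W p hx.1 hy.1 ha hb hab, fun e he => ?_, fun e he => ?_⟩
  · have h1 := hx.2.1 e he
    have h2 := hy.2.1 e he
    rcases ha.eq_or_lt with rfl | ha'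
    · have : b = 1 := by linarith
      simp [this, h2]
    · have := mul_pos ha' h1
      have := mul_nonneg hb h2.le
      simp only [Pi.add_apply, Pi.smul_apply, smul_eq_mul]
      linarith
  · simp [hx.2.2 e he, hy.2.2 e he]

lemma exists_image_openCell_eq_Ioo {E : Type*} [Finite E] {W : Submodule ℝ (E → ℝ)}
    {p w : E → ℝ} {S : Finset E} {e : E} {B : ℝ} (hne : (openCell W p S).Nonempty)
    (hB : ∀ x ∈ openCell W p S, x e ≤ B) (hw : w ∈ supportedPart W S) (hwe : w e ≠ 0) :
    ∃ a b, a < b ∧ (fun x : E → ℝ => x e) '' openCell W p S = Set.Ioo a b := by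
  apply eq_Ioo_of_isOpen
  · rw [isOpen_iff_mem_nhds]
    rintro _ ⟨y, hy, rfl⟩
    have hc : Filter.Tendsto (fun t : ℝ => (t - y e) / w e) (nhds (y e)) (nhds 0) := by
      have : Continuous fun t : ℝ => (t - y e) / w e := by fun_prop
      simpa using this.tendsto (y e)
    filter_upwards [hc.eventually (add_smul_mem_openCell hy hw)] with t ht
    refine ⟨_, ht, ?_⟩
    simp [hwe]
  · have hconv : Convex ℝ ((fun x : E → ℝ => x e) '' openCell W p S) :=
      (convex_openCell W p S).is_linear_image
        (LinearMap.proj e : (E → ℝ) →ₗ[ℝ] ℝ).isLinear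
    exact hconv.ordConnected
  · exact hne.image _
  · refine ⟨0, ?_⟩
    rintro _ ⟨y, hy, rfl⟩
    exact openCell_nonneg hy e
  · refine ⟨B, ?_⟩
    rintro _ ⟨y, hy, rfl⟩
    exact hB y hy

/-- Sweeping an open cell along the coordinate `e` computes its signed dimension. -/
lemma exists_sum_jump_openCell {E : Type*} [Finite E] (W : Submodule ℝ (E → ℝ)) (p : E → ℝ)
    (e : E) {B : ℝ} (hB : ∀ x : E → ℝ, 0 ≤ x → x - p ∈ W → x e ≤ B) (S : Finset E) :
    ∃ T₀ : Finset ℝ, ∀ T : Finset ℝ, T₀ ⊆ T → ∀ ε > 0,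
      (∀ s ∈ T, ∀ t ∈ T, s < t → s + ε < t) →
      ∑ t ∈ T,
        ((if ∃ x ∈ openCell W p S, x e = t then
            (-1 : ℝ) ^ Module.finrank ℝ (supportedPart (coordSlice W e) S) else 0) -
          if ∃ x ∈ openCell W p S, x e = t + ε then
            (-1 : ℝ) ^ Module.finrank ℝ (supportedPart (coordSlice W e) S) else 0) =
      if (openCell W p S).Nonempty then (-1 : ℝ) ^ Module.finrank ℝ (supportedPart W S)
        else 0 := by
  by_cases hne : (openCell W p S).Nonempty
  swap
  · refine ⟨∅, fun T _ ε _ _ => ?_⟩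
    have : ∀ t, ¬ ∃ x ∈ openCell W p S, x e = t := fun t ⟨x, hx, _⟩ => hne ⟨x, hx⟩
    simp [hne, this]
  rw [supportedPart_coordSlice]
  simp only [if_pos hne]
  obtain ⟨x, hx⟩ := hne
  by_cases hw : ∃ w ∈ supportedPart W S, w e ≠ 0
  · obtain ⟨w, hw, hwe⟩ := hw
    have hrank : Module.finrank ℝ (coordSlice (supportedPart W S) e) + 1 =
        Module.finrank ℝ (supportedPart W S) :=
      finrank_coordSlice_add_one (supportedPart W S) hw hwe
    obtain ⟨a, b, hab, himage⟩ :=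
      exists_image_openCell_eq_Ioo ⟨x, hx⟩ (fun x hx => hB x (openCell_nonneg hx) hx.1) hw hwe
    refine ⟨{a, b}, fun T hT ε hε hgap => ?_⟩
    have hiff : ∀ t, (∃ x ∈ openCell W p S, x e = t) ↔ t ∈ Set.Ioo a b := fun t => by
      rw [← himage]
      rfl
    rw [sum_jump_eq_mul hiff, sum_jump_Ioo hε hgap (hT (by simp)) (hT (by simp)) hab,
      ← hrank, pow_succ]
  · push Not at hw
    have hslice : coordSlice (supportedPart W S) e = supportedPart W S :=
      inf_eq_left.2 fun w h => hw w h
    refine ⟨{x e}, fun T hT ε hε hgap => ?_⟩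
    have hiff : ∀ t, (∃ x ∈ openCell W p S, x e = t) ↔ t ∈ Set.Icc (x e) (x e) := fun t => by
      rw [Set.Icc_self, Set.mem_singleton_iff]
      constructor
      · rintro ⟨y, hy, rfl⟩
        have : y - x ∈ supportedPart W S := by
          refine ⟨?_, fun f hf => by simp [hx.2.2 f hf, hy.2.2 f hf]⟩
          simpa using W.sub_mem hy.1 hx.1
        simpa [sub_eq_zero] using hw _ this
      · rintro rfl
        exact ⟨x, hx, rfl⟩
    rw [sum_jump_eq_mul hiff, sum_jump_Icc hε hgap (hT (by simp)) (hT (by simp)) le_rfl,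
      hslice, mul_one]

lemma image_coord_eq_Icc {E : Type*} [Finite E] (W : Submodule ℝ (E → ℝ)) {p : E → ℝ}
    (hp : 0 ≤ p) {B : ℝ} (hB : ∀ x : E → ℝ, 0 ≤ x → x - p ∈ W → ∀ e, x e ≤ B) (e : E) :
    ∃ a b : ℝ, a ≤ b ∧ ∀ t, (∃ x : E → ℝ, 0 ≤ x ∧ x - p ∈ W ∧ x e = t) ↔ t ∈ Set.Icc a b := by
  have := Fintype.ofFinite E
  set P : Set (E → ℝ) := {x | 0 ≤ x ∧ x - p ∈ W} with hP
  have hclosed : IsClosed P :=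
    isClosed_Ici.inter ((Submodule.closed_of_finiteDimensional W).preimage
      (by fun_prop : Continuous fun x : E → ℝ => x - p))
  have hcompact : IsCompact P :=
    (isCompact_Icc (a := (0 : E → ℝ)) (b := fun _ => B)).of_isClosed_subset hclosed
      fun x hx => ⟨hx.1, hB x hx.1 hx.2⟩
  have hconvex : Convex ℝ P := by
    intro x hx y hy a b ha hb hab
    exact ⟨add_nonneg (smul_nonneg ha hx.1) (smul_nonneg hb hy.1),
      convex_setOf_sub_mem W p hx.2 hy.2 ha hb hab⟩
  have hpP : p ∈ P := ⟨hp, by simp⟩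
  have hcont : Continuous fun x : E → ℝ => x e := continuous_apply e
  have himage := eq_Icc_of_connected_compact
    (((hconvex.isConnected ⟨p, hpP⟩).image _ hcont.continuousOn)) (hcompact.image hcont)
  have hmem : p e ∈ (fun x : E → ℝ => x e) '' P := ⟨p, hpP, rfl⟩
  refine ⟨sInf ((fun x : E → ℝ => x e) '' P), sSup ((fun x : E → ℝ => x e) '' P), ?_,
    fun t => ?_⟩
  · rw [himage] at hmem
    exact hmem.1.trans hmem.2
  · rw [← himage]
    simp [hP, and_assoc]

/-- **Euler's relation** for the polytope of nonnegative points of `p + W`, whose faces are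
indexed by supports. -/
theorem sum_neg_one_pow_finrank_openCell {E : Type*} [Fintype E] (W : Submodule ℝ (E → ℝ))
    {p : E → ℝ} (hp : 0 ≤ p) {B : ℝ}
    (hB : ∀ x : E → ℝ, 0 ≤ x → x - p ∈ W → ∀ e, x e ≤ B) :
    ∑ S : Finset E, (if (openCell W p S).Nonempty then
      (-1 : ℝ) ^ Module.finrank ℝ (supportedPart W S) else 0) = 1 := by
  induction hd : Module.finrank ℝ W using Nat.strong_induction_on generalizing W p with
  | _ d ih =>
  subst hd
  by_cases hconst : ∀ x : E → ℝ, 0 ≤ x → x - p ∈ W → x = p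
  · set S₀ : Finset E := Finset.univ.filter fun e => 0 < p e with hS₀
    have hpS : p ∈ openCell W p S₀ :=
      ⟨by simp, fun e he => by simpa [hS₀] using he,
        fun e he => le_antisymm (by simpa [hS₀] using he) (hp e)⟩
    rw [Finset.sum_eq_single S₀]
    · have hbot : supportedPart W S₀ = ⊥ := by
        rw [Submodule.eq_bot_iff]
        intro w hw
        obtain ⟨δ, hδ, hδ0⟩ := (((add_smul_mem_openCell hpS hw).filter_mono
          nhdsWithin_le_nhds).and (self_mem_nhdsWithin (s := {0}ᶜ))).exists
        have := hconst _ (openCell_nonneg hδ) hδ.1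
        rw [add_eq_left] at this
        exact (smul_eq_zero.1 this).resolve_left hδ0
      rw [if_pos ⟨p, hpS⟩, hbot, finrank_bot, pow_zero]
    · intro S _ hS
      rw [if_neg]
      rintro ⟨x, hx⟩
      obtain rfl := hconst x (openCell_nonneg hx) hx.1
      apply hS
      ext e
      by_cases he : e ∈ S
      · simp [hS₀, he, hx.2.1 e he]
      · simp [hS₀, he, hx.2.2 e he]
    · simp
  · push Not at hconst
    obtain ⟨y, hy, hyW, hyp⟩ := hconst
    obtain ⟨e, he⟩ := Function.ne_iff.1 hyp
    obtain ⟨a, b, hab, himage⟩ := image_coord_eq_Icc W hp hB e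
    choose T₀ hT₀ using
      exists_sum_jump_openCell W p e (fun x h h' => hB x h h' e)
    set T : Finset ℝ := {a, b} ∪ Finset.univ.biUnion T₀ with hT
    obtain ⟨ε, hε, hgap⟩ := exists_gap T
    have hslice : ∀ t, (∑ S : Finset E, if ∃ x ∈ openCell W p S, x e = t then
        (-1 : ℝ) ^ Module.finrank ℝ (supportedPart (coordSlice W e) S) else 0) =
        if t ∈ Set.Icc a b then 1 else 0 := by
      intro t
      split_ifs with ht
      · obtain ⟨q, hq, hqW, rfl⟩ := (himage t).2 ht
        have hlt : Module.finrank ℝ (coordSlice W e) < Module.finrank ℝ W := by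
          rw [← finrank_coordSlice_add_one W hyW (by simpa [sub_eq_zero] using he)]
          exact Nat.lt_succ_self _
        have := ih _ hlt (coordSlice W e) hq (fun x hx hxW => hB x hx (by
          simpa using W.add_mem hxW.1 hqW)) rfl
        simpa only [exists_openCell_coord_iff hqW] using this
      · refine Finset.sum_eq_zero fun S _ => if_neg ?_
        rintro ⟨x, hx, rfl⟩
        exact ht ((himage _).1 ⟨x, openCell_nonneg hx, hx.1, rfl⟩)
    refine Eq.trans ?_ (sum_jump_Icc hε hgap (by simp [hT]) (by simp [hT]) hab)
    simp only [← hslice, ← Finset.sum_sub_distrib]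
    rw [Finset.sum_comm]
    refine Finset.sum_congr rfl fun S _ => (hT₀ S T ?_ ε hε hgap).symm
    exact (Finset.subset_biUnion_of_mem T₀ (Finset.mem_univ S)).trans Finset.subset_union_right

/-- Edge weights of `K_{n,n}` with vanishing sum at every vertex. -/
def balanced (n : ℕ) : Submodule ℝ (Edge n → ℝ) where
  carrier := {x | (∀ i, ∑ j, x (i, j) = 0) ∧ ∀ j, ∑ i, x (i, j) = 0}
  add_mem' := fun {x y} hx hy =>
    ⟨fun i => by simp [Finset.sum_add_distrib, hx.1, hy.1],
      fun j => by simp [Finset.sum_add_distrib, hx.2, hy.2]⟩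
  zero_mem' := by simp
  smul_mem' := fun c x hx =>
    ⟨fun i => by simp [← Finset.mul_sum, hx.1], fun j => by simp [← Finset.mul_sum, hx.2]⟩

/-- The signed incidence matrix of the bipartite graph with edge set `G`. -/
noncomputable def signedIncidence {n : ℕ} (G : Finset (Edge n)) :
    Matrix (Fin n ⊕ Fin n) G ℝ :=
  Matrix.of fun v e => Sum.elim (fun i => if e.1.1 = i then 1 else 0)
    (fun j => if e.1.2 = j then -1 else 0) v

lemma transpose_signedIncidence_mulVec {n : ℕ} (G : Finset (Edge n)) (u : Fin n ⊕ Fin n → ℝ)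
    (e : G) : ((signedIncidence G).transpose.mulVec u) e =
      u (Sum.inl e.1.1) - u (Sum.inr e.1.2) := by
  simp [Matrix.mulVec, dotProduct, signedIncidence, sub_eq_add_neg]

lemma ker_transpose_signedIncidence {n : ℕ} (G : Finset (Edge n)) :
    LinearMap.ker (signedIncidence G).transpose.mulVecLin =
      LinearMap.ker (Matrix.toLin' ((graphOn G).lapMatrix ℝ)) := by
  ext u
  rw [LinearMap.mem_ker, LinearMap.mem_ker, Matrix.toLin'_apply,
    SimpleGraph.lapMatrix_mulVec_eq_zero_iff_forall_adj, Matrix.mulVecLin_apply, funext_iff]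
  simp only [transpose_signedIncidence_mulVec, Pi.zero_apply, sub_eq_zero]
  constructor
  · rintro h i j ⟨-, ⟨e, he, rfl, rfl⟩ | ⟨e, he, rfl, rfl⟩⟩
    · exact h ⟨e, he⟩
    · exact (h ⟨e, he⟩).symm
  · intro h e
    exact h _ _ ⟨by simp, Or.inl ⟨e.1, e.2, rfl, rfl⟩⟩

lemma sum_ite_fst_eq {n : ℕ} {G : Finset (Edge n)} {x : Edge n → ℝ} (hx : ∀ e ∉ G, x e = 0)
    (i : Fin n) : ∑ e : G, (if e.1.1 = i then x e.1 else 0) = ∑ j, x (i, j) := by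
  rw [Finset.sum_coe_sort G (fun e => if e.1 = i then x e else 0),
    Finset.sum_subset (Finset.subset_univ G) (fun e _ he => by simp [hx e he]),
    Fintype.sum_prod_type_right]
  simp

lemma sum_ite_snd_eq {n : ℕ} {G : Finset (Edge n)} {x : Edge n → ℝ} (hx : ∀ e ∉ G, x e = 0)
    (j : Fin n) : ∑ e : G, (if e.1.2 = j then x e.1 else 0) = ∑ i, x (i, j) := by
  rw [Finset.sum_coe_sort G (fun e => if e.2 = j then x e else 0),
    Finset.sum_subset (Finset.subset_univ G) (fun e _ he => by simp [hx e he]),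
    Fintype.sum_prod_type]
  simp

lemma restrict_mem_ker_signedIncidence {n : ℕ} {G : Finset (Edge n)} {x : Edge n → ℝ}
    (hx : ∀ e ∉ G, x e = 0) :
    (fun e : G => x e.1) ∈ LinearMap.ker (signedIncidence G).mulVecLin ↔ x ∈ balanced n := by
  have hl : ∀ i, ((signedIncidence G).mulVec fun e : G => x e.1) (Sum.inl i) =
      ∑ j, x (i, j) := fun i => by
    rw [← sum_ite_fst_eq hx]
    simp [Matrix.mulVec, dotProduct, signedIncidence]
  have hr : ∀ j, ((signedIncidence G).mulVec fun e : G => x e.1) (Sum.inr j) =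
      -∑ i, x (i, j) := fun j => by
    rw [← sum_ite_snd_eq hx, ← Finset.sum_neg_distrib]
    refine Finset.sum_congr rfl fun e _ => ?_
    simp only [signedIncidence, Matrix.of_apply, Sum.elim_inr]
    split_ifs <;> simp
  rw [LinearMap.mem_ker, Matrix.mulVecLin_apply, funext_iff, Sum.forall]
  simp only [hl, hr, Pi.zero_apply, neg_eq_zero]
  rfl

/-- Balanced weights supported on `G` are the kernel of the signed incidence matrix of `G`. -/
noncomputable def supportedPartEquiv {n : ℕ} (G : Finset (Edge n)) :
    supportedPart (balanced n) G ≃ₗ[ℝ] LinearMap.ker (signedIncidence G).mulVecLin where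
  toFun x := ⟨fun e => x.1 e.1, (restrict_mem_ker_signedIncidence x.2.2).2 x.2.1⟩
  map_add' _ _ := rfl
  map_smul' _ _ := rfl
  invFun y := ⟨fun e => if h : e ∈ G then y.1 ⟨e, h⟩ else 0, by
    have h0 : ∀ e ∉ G, (if h : e ∈ G then y.1 ⟨e, h⟩ else 0) = 0 := fun e he => dif_neg he
    refine ⟨(restrict_mem_ker_signedIncidence h0).1 ?_, h0⟩
    convert y.2 with e
    simp⟩
  left_inv x := by
    ext e
    by_cases he : e ∈ G
    · simp [he]
    · simp [he, x.2.2 e he]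
  right_inv y := by
    ext e
    simp

lemma cyclo_eq_finrank {n : ℕ} (G : Finset (Edge n)) :
    cyclo G = Module.finrank ℝ (supportedPart (balanced n) G) := by
  have hcomp : numComponents G =
      Module.finrank ℝ (LinearMap.ker (signedIncidence G).transpose.mulVecLin) := by
    rw [ker_transpose_signedIncidence, numComponents, Nat.card_eq_fintype_card,
      SimpleGraph.card_connectedComponent_eq_finrank_ker_toLin'_lapMatrix]
  have h1 := LinearMap.finrank_range_add_finrank_ker (signedIncidence G).mulVecLin
  have h2 := LinearMap.finrank_range_add_finrank_ker (signedIncidence G).transpose.mulVecLin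
  have h3 : Module.finrank ℝ (LinearMap.range (signedIncidence G).transpose.mulVecLin) =
      Module.finrank ℝ (LinearMap.range (signedIncidence G).mulVecLin) :=
    Matrix.rank_transpose (signedIncidence G)
  rw [Module.finrank_fintype_fun_eq_card, Fintype.card_coe] at h1
  rw [Module.finrank_fintype_fun_eq_card, Fintype.card_sum, Fintype.card_fin] at h2
  rw [(supportedPartEquiv G).finrank_eq, cyclo, hcomp]
  omega

lemma mem_image_graph_iff {n : ℕ} (σ : Equiv.Perm (Fin n)) (e : Edge n) :
    e ∈ Finset.univ.image (fun i => (i, σ i)) ↔ σ e.1 = e.2 := by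
  rcases e with ⟨i, j⟩
  simp

/-- The 0-1 vector of the perfect matching given by `σ`. -/
noncomputable def matchingVector {n : ℕ} (σ : Equiv.Perm (Fin n)) (e : Edge n) : ℝ :=
  if σ e.1 = e.2 then 1 else 0

lemma sub_matchingVector_mem_balanced_iff {n : ℕ} (σ : Equiv.Perm (Fin n)) (x : Edge n → ℝ) :
    x - matchingVector σ ∈ balanced n ↔
      (∀ i, ∑ j, x (i, j) = 1) ∧ ∀ j, ∑ i, x (i, j) = 1 := by
  have h : ∀ j, ∑ i, (if σ i = j then (1 : ℝ) else 0) = 1 := fun j => by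
    rw [Equiv.sum_comp σ fun k => if k = j then (1 : ℝ) else 0]
    simp
  change (_ ∧ _) ↔ _
  simp [matchingVector, sub_eq_zero, h]

lemma matchingCovered_of_doublyStochastic {n : ℕ} {S : Finset (Edge n)} {x : Edge n → ℝ}
    (hpos : ∀ e ∈ S, 0 < x e) (hzero : ∀ e ∉ S, x e = 0)
    (hrow : ∀ i, ∑ j, x (i, j) = 1) (hcol : ∀ j, ∑ i, x (i, j) = 1) : matchingCovered S := by
  have hmem : (Matrix.of fun i j => x (i, j)) ∈ doublyStochastic ℝ (Fin n) := by
    rw [mem_doublyStochastic_iff_sum]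
    refine ⟨fun i j => ?_, hrow, hcol⟩
    by_cases h : (i, j) ∈ S
    · exact (hpos _ h).le
    · exact (hzero _ h).ge
  obtain ⟨w, hw, hw1, hwx⟩ := exists_eq_sum_perm_of_mem_doublyStochastic hmem
  have hx : ∀ e : Edge n, x e = ∑ σ : Equiv.Perm (Fin n), if σ e.1 = e.2 then w σ else 0 := by
    rintro ⟨i, j⟩
    have := congrFun (congrFun hwx i) j
    simp only [Matrix.sum_apply, Matrix.smul_apply, Matrix.of_apply] at this
    rw [← this]
    refine Finset.sum_congr rfl fun σ _ => ?_
    simp [Equiv.Perm.permMatrix, PEquiv.toMatrix_apply, eq_comm]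
  refine ⟨(Finset.univ.filter fun σ => 0 < w σ).image
    fun σ => Finset.univ.image fun i => (i, σ i), ?_, ?_, ?_⟩
  · obtain ⟨σ, -, hσ⟩ := Finset.exists_lt_of_sum_lt
      (show ∑ σ : Equiv.Perm (Fin n), (0 : ℝ) < ∑ σ, w σ by simp [hw1])
    exact ⟨_, Finset.mem_image_of_mem _ (by simpa using hσ)⟩
  · simp only [Finset.mem_image]
    rintro M ⟨σ, -, rfl⟩
    exact ⟨σ, rfl⟩
  · ext e
    simp only [Finset.mem_sup, Finset.exists_mem_image, Finset.mem_filter, Finset.mem_univ,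
      true_and, id_eq, mem_image_graph_iff]
    have hterm : ∀ σ ∈ (Finset.univ : Finset (Equiv.Perm (Fin n))),
        0 ≤ if σ e.1 = e.2 then w σ else 0 := fun σ _ => by
      split_ifs
      exacts [hw σ, le_rfl]
    constructor
    · rintro ⟨σ, hσ, he⟩
      by_contra heS
      have := (Finset.sum_eq_zero_iff_of_nonneg hterm).1 ((hx e).symm.trans (hzero e heS)) σ
        (Finset.mem_univ σ)
      rw [if_pos he] at this
      exact hσ.ne' this
    · intro he
      have := hpos e he
      rw [hx e] at this
      obtain ⟨σ, -, hσ⟩ := Finset.exists_lt_of_sum_lt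
        (show ∑ σ : Equiv.Perm (Fin n), (0 : ℝ) < _ by simpa using this)
      by_cases h : σ e.1 = e.2
      · exact ⟨σ, by simpa [h] using hσ, h⟩
      · simp [h] at hσ

lemma matchingCovered.exists_doublyStochastic {n : ℕ} {S : Finset (Edge n)}
    (hS : matchingCovered S) : ∃ x : Edge n → ℝ, (∀ e ∈ S, 0 < x e) ∧ (∀ e ∉ S, x e = 0) ∧
      (∀ i, ∑ j, x (i, j) = 1) ∧ ∀ j, ∑ i, x (i, j) = 1 := by
  obtain ⟨𝓜, hne, hPM, rfl⟩ := hS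
  have hcard : (0 : ℝ) < 𝓜.card := by exact_mod_cast hne.card_pos
  refine ⟨fun e => (∑ M ∈ 𝓜, if e ∈ M then (1 : ℝ) else 0) / 𝓜.card, fun e he => ?_,
    fun e he => ?_, fun i => ?_, fun j => ?_⟩
  · obtain ⟨M, hM, heM⟩ := Finset.mem_sup.1 he
    refine div_pos (Finset.sum_pos' (fun _ _ => by split_ifs <;> simp) ⟨M, hM, ?_⟩) hcard
    rw [if_pos (by simpa using heM)]
    exact one_pos
  · have h0 : ∑ M ∈ 𝓜, (if e ∈ M then (1 : ℝ) else 0) = 0 :=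
      Finset.sum_eq_zero fun M hM => if_neg fun heM => he (Finset.mem_sup.2 ⟨M, hM, heM⟩)
    simp only [h0, zero_div]
  · rw [← Finset.sum_div, Finset.sum_comm, div_eq_one_iff_eq hcard.ne', Finset.cast_card]
    refine Finset.sum_congr rfl fun M hM => ?_
    obtain ⟨σ, rfl⟩ := hPM M hM
    simp only [mem_image_graph_iff]
    simp
  · rw [← Finset.sum_div, Finset.sum_comm, div_eq_one_iff_eq hcard.ne', Finset.cast_card]
    refine Finset.sum_congr rfl fun M hM => ?_
    obtain ⟨σ, rfl⟩ := hPM M hM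
    simp only [mem_image_graph_iff]
    rw [Equiv.sum_comp σ fun k => if k = j then (1 : ℝ) else 0]
    simp

lemma matchingCovered.hasPM {n : ℕ} {G H : Finset (Edge n)} (hG : matchingCovered G)
    (hGH : G ⊆ H) : hasPM H := by
  obtain ⟨𝓜, ⟨M, hM⟩, hPM, rfl⟩ := hG
  obtain ⟨σ, rfl⟩ := hPM M hM
  refine ⟨σ, fun i => hGH (Finset.mem_sup.2 ⟨_, hM, ?_⟩)⟩
  simp

lemma openCell_matchingVector_nonempty_iff {n : ℕ} {H : Finset (Edge n)}
    {σ : Equiv.Perm (Fin n)} (hσ : ∀ i, (i, σ i) ∈ H) (S : Finset (Edge n)) :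
    (openCell (supportedPart (balanced n) H) (matchingVector σ) S).Nonempty ↔
      matchingCovered S ∧ S ⊆ H := by
  have hv : ∀ e ∉ H, matchingVector σ e = 0 := by
    rintro ⟨i, j⟩ he
    refine if_neg ?_
    rintro (rfl : σ i = j)
    exact he (hσ i)
  constructor
  · rintro ⟨x, ⟨hbal, hsupp⟩, hpos, hzero⟩
    obtain ⟨hrow, hcol⟩ := (sub_matchingVector_mem_balanced_iff σ x).1 hbal
    refine ⟨matchingCovered_of_doublyStochastic hpos hzero hrow hcol, fun e he => ?_⟩
    by_contra heH
    have := hsupp e heH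
    rw [Pi.sub_apply, hv e heH, sub_zero] at this
    exact (hpos e he).ne' this
  · rintro ⟨hS, hSH⟩
    obtain ⟨x, hpos, hzero, hsum⟩ := hS.exists_doublyStochastic
    refine ⟨x, ⟨(sub_matchingVector_mem_balanced_iff σ x).2 hsum, fun e he => ?_⟩, hpos, hzero⟩
    rw [Pi.sub_apply, hv e he, hzero e fun h => he (hSH h), sub_zero]

lemma supportedPart_supportedPart {E : Type*} {W : Submodule ℝ (E → ℝ)} {S H : Finset E}
    (h : S ⊆ H) : supportedPart (supportedPart W H) S = supportedPart W S := by
  ext x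
  simp only [mem_supportedPart]
  exact ⟨fun hx => ⟨hx.1.1, hx.2⟩,
    fun hx => ⟨⟨hx.1, fun e he => hx.2 e fun h' => he (h h')⟩, hx.2⟩⟩

/-- The coefficients of the bipartite perfect matching polynomial are `(-1) ^ χ(G)`. -/
theorem sum_matchingCovered_subset {n : ℕ} (H : Finset (Edge n)) :
    (∑ G : Finset (Edge n), if matchingCovered G ∧ G ⊆ H then (-1 : ℝ) ^ cyclo G else 0) =
      if hasPM H then 1 else 0 := by
  split_ifs with hH
  · obtain ⟨σ, hσ⟩ := hH
    have hnonneg : 0 ≤ matchingVector σ := fun e => by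
      unfold matchingVector
      split_ifs <;> simp
    refine Eq.trans ?_
      (sum_neg_one_pow_finrank_openCell (supportedPart (balanced n) H) hnonneg (B := 1) ?_)
    · refine Finset.sum_congr rfl fun G _ => ?_
      have hiff := openCell_matchingVector_nonempty_iff hσ G
      by_cases h : matchingCovered G ∧ G ⊆ H
      swap
      · rw [if_neg h, if_neg (mt hiff.1 h)]
      rw [if_pos h, if_pos (hiff.2 h), cyclo_eq_finrank, zpow_natCast,
        supportedPart_supportedPart h.2]
    · rintro x hx hxW ⟨i, j⟩
      rw [← ((sub_matchingVector_mem_balanced_iff σ x).1 hxW.1).1 i]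
      exact Finset.single_le_sum (f := fun j => x (i, j)) (fun k _ => hx (i, k))
        (Finset.mem_univ j)
  · exact Finset.sum_eq_zero fun G _ => if_neg fun h => hH (h.1.hasPM h.2)

lemma card_filter_superset {n : ℕ} (G : Finset (Edge n)) :
    (Finset.univ.filter fun H => G ⊆ H).card = 2 ^ (n ^ 2 - G.card) := by
  have h : (Finset.univ.filter fun H => G ⊆ H) = Finset.Icc G Finset.univ := by
    ext H
    simp
  rw [h, Finset.card_Icc_finset (Finset.subset_univ G)]
  simp [sq]

/-- the probability that a uniformly random balanced bipartite graph on parts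
of size `n` (each edge present independently with probability `1/2`) contains a perfect
matching equals `∑_{G ∈ MC_n} (−1)^{χ(G)} / 2^{|E(G)|}`. -/
theorem stmt16 (n : ℕ) :
    ((Finset.univ.filter fun G : Finset (Edge n) => hasPM G).card : ℝ) / 2 ^ (n ^ 2)
      = ∑ G ∈ Finset.univ.filter fun G : Finset (Edge n) => matchingCovered G,
          (-1 : ℝ) ^ (cyclo G) / 2 ^ (G.card) := by
  rw [← Finset.sum_boole]
  simp only [← sum_matchingCovered_subset]
  rw [Finset.sum_comm, Finset.sum_div, Finset.sum_filter]
  refine Finset.sum_congr rfl fun G _ => ?_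
  by_cases hG : matchingCovered G
  · have hcard : G.card ≤ n ^ 2 := by
      simpa [sq] using Finset.card_le_univ G
    simp only [hG, true_and, if_true]
    rw [← Finset.sum_filter, Finset.sum_const, card_filter_superset, nsmul_eq_mul,
      Nat.cast_pow, Nat.cast_ofNat, div_eq_div_iff (by positivity) (by positivity),
      mul_right_comm, ← pow_add, Nat.sub_add_cancel hcard, mul_comm]
  · simp [hG]
end

section
/- For n > 1, the number of monomials with nonzero coefficient in the real multilinear polynomial of BPM*_n satisfies (n!)² ≤ |mon(BPM*_n)| ≤ Σ_{k=1}^{n+1} ((k−1)! · S(n+1,k))² < (n+2)^{2n+2}, where S(·,·) denotes Stirling numbers of the second kind. In particular log₂|mon(BPM*_n)| = Θ(n log n). -/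
open Finset
open scoped Classical

/-- Stirling numbers of the second kind `S(n, k)`: the number of partitions of an
`n`-element set into `k` nonempty blocks. -/
def stirling2 : ℕ → ℕ → ℕ
  | 0, 0 => 1
  | 0, _ + 1 => 0
  | _ + 1, 0 => 0
  | n + 1, k + 1 => (k + 1) * stirling2 n (k + 1) + stirling2 n k

/-- The complement of `T` in `K_{n,n}` contains a perfect matching. -/
def complHasPM {n : ℕ} (T : Finset (Edge n)) : Prop :=
  ∃ ρ : Equiv.Perm (Fin n), ∀ i, (i, ρ i) ∉ T

lemma complHasPM.anti {n : ℕ} {T U : Finset (Edge n)} (h : complHasPM U) (hTU : T ⊆ U) :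
    complHasPM T := by
  obtain ⟨ρ, hρ⟩ := h
  exact ⟨ρ, fun i hi => hρ i (hTU hi)⟩

/-- The Hall condition for the complement of `T`. -/
lemma exists_card_lt_of_not_complHasPM {n : ℕ} {T : Finset (Edge n)} (h : ¬ complHasPM T) :
    ∃ X : Finset (Fin n), (univ.filter fun j => ∃ i ∈ X, (i, j) ∉ T).card < X.card := by
  by_contra! hX
  apply h
  have := (Finset.all_card_le_biUnion_card_iff_exists_injective
    (fun i : Fin n => univ.filter fun j => (i, j) ∉ T)).1 (fun X => by
      refine (hX X).trans (Finset.card_le_card fun j hj => ?_)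
      simpa using hj)
  obtain ⟨f, hf, hft⟩ := this
  refine ⟨Equiv.ofBijective f (Finite.injective_iff_bijective.1 hf), fun i => ?_⟩
  simpa using hft i

lemma not_complHasPM_of_card_lt {n : ℕ} {T : Finset (Edge n)} (X : Finset (Fin n))
    (hX : (univ.filter fun j => ∃ i ∈ X, (i, j) ∉ T).card < X.card) : ¬ complHasPM T := by
  rintro ⟨ρ, hρ⟩
  refine absurd (Finset.card_le_card_of_injOn (s := X)
    (t := univ.filter fun j => ∃ i ∈ X, (i, j) ∉ T) ρ (fun i hi => ?_) ρ.injective.injOn)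
    (not_le.2 hX)
  simpa using ⟨i, hi, hρ i⟩

lemma sum_powerset_coeff {n : ℕ} {a : Finset (Edge n) → ℝ}
    (ha : ∀ x : Edge n → Bool, (∑ S : Finset (Edge n), a S * ∏ e ∈ S, (if x e then (1 : ℝ) else 0))
        = (if BPMb n (fun e => ! x e) then 0 else 1)) (T : Finset (Edge n)) :
    ∑ S ∈ T.powerset, a S = if complHasPM T then 0 else 1 := by
  have h := ha (fun e => decide (e ∈ T))
  have h1 : BPMb n (fun e => ! decide (e ∈ T)) ↔ complHasPM T := by
    simp [BPMb, complHasPM]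
  rw [if_congr h1 rfl rfl] at h
  rw [← h, ← Finset.sum_subset (Finset.subset_univ T.powerset)]
  · refine Finset.sum_congr rfl fun S hS => ?_
    rw [Finset.prod_eq_one, mul_one]
    intro e he
    simp [Finset.mem_powerset.1 hS he]
  · intro S _ hS
    rw [Finset.mem_powerset, Finset.not_subset] at hS
    obtain ⟨e, he, heT⟩ := hS
    rw [Finset.prod_eq_zero he (by simp [heT]), mul_zero]

/-- An induced matching of size two in `S`, with the missing edges present in the complement,
forces the second difference of the matching function to vanish. -/
lemma second_difference_eq_zero {n : ℕ} {S : Finset (Edge n)} {a a' b b' : Fin n}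
    (h1 : (a, b) ∈ S) (h3 : (a, b') ∉ S) (h4 : (a', b) ∉ S) :
    (if complHasPM S then (0 : ℝ) else 1) + (if complHasPM ((S.erase (a, b)).erase (a', b'))
      then 0 else 1) = (if complHasPM (S.erase (a, b)) then 0 else 1)
      + (if complHasPM (S.erase (a', b')) then 0 else 1) := by
  have hs1 : S.erase (a, b) ⊆ S := Finset.erase_subset _ _
  have hs2 : S.erase (a', b') ⊆ S := Finset.erase_subset _ _
  have hs3 : (S.erase (a, b)).erase (a', b') ⊆ S.erase (a, b) := Finset.erase_subset _ _
  have hs4 : (S.erase (a, b)).erase (a', b') ⊆ S.erase (a', b') :=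
    Finset.erase_subset_erase _ hs1
  have haa : a ≠ a' := by rintro rfl; exact h4 h1
  by_cases hS : complHasPM S
  · simp [hS, hS.anti hs1, hS.anti hs2, hS.anti (hs3.trans hs1)]
  have hor : complHasPM ((S.erase (a, b)).erase (a', b')) →
      complHasPM (S.erase (a, b)) ∨ complHasPM (S.erase (a', b')) := by
    rintro ⟨ρ, hρ⟩
    simp only [Finset.mem_erase, not_and, ne_eq, Prod.mk.injEq] at hρ
    by_cases hb : ρ a = b
    · by_cases hb' : ρ a' = b'
      · refine absurd ⟨ρ * Equiv.swap a a', fun i => ?_⟩ hS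
        rcases eq_or_ne i a with rfl | hi
        · simpa [hb'] using h3
        rcases eq_or_ne i a' with rfl | hi'
        · simpa [hb] using h4
        rw [Equiv.Perm.mul_apply, Equiv.swap_apply_of_ne_of_ne hi hi']
        exact hρ i (fun h => absurd h hi') (fun h => absurd h hi)
      · refine Or.inl ⟨ρ, fun i => ?_⟩
        simp only [Finset.mem_erase, not_and, ne_eq, Prod.mk.injEq]
        exact hρ i (by rintro rfl h; exact hb' h)
    · refine Or.inr ⟨ρ, fun i => ?_⟩
      simp only [Finset.mem_erase, not_and, ne_eq, Prod.mk.injEq]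
      exact fun h => hρ i h (by rintro rfl h; exact hb h)
  have hnand : complHasPM (S.erase (a, b)) → ¬ complHasPM (S.erase (a', b')) := by
    intro hp hp'
    obtain ⟨X, hX⟩ := exists_card_lt_of_not_complHasPM hS
    have key : ∀ c d : Fin n, complHasPM (S.erase (c, d)) →
        c ∈ X ∧ ∀ i ∈ X, (i, d) ∈ S := by
      intro c d hcd
      by_contra hc
      refine not_complHasPM_of_card_lt X (lt_of_le_of_lt (Finset.card_le_card ?_) hX) hcd
      intro j hj
      simp only [Finset.mem_filter, Finset.mem_univ, true_and, Finset.mem_erase, not_and] at hj ⊢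
      obtain ⟨i, hi, hij⟩ := hj
      by_cases hijc : (i, j) = (c, d)
      · simp only [Prod.mk.injEq] at hijc
        obtain ⟨rfl, rfl⟩ := hijc
        by_contra! hcon
        exact hc ⟨hi, hcon⟩
      · exact ⟨i, hi, hij hijc⟩
    exact h3 ((key _ _ hp').2 a (key _ _ hp).1)
  by_cases hp : complHasPM (S.erase (a, b))
  · simp [hS, hp, hnand hp, hp.anti hs3]
  · by_cases hp' : complHasPM (S.erase (a', b'))
    · simp [hS, hp, hp', hp'.anti hs4]
    · have : ¬ complHasPM ((S.erase (a, b)).erase (a', b')) := fun h => (hor h).elim hp hp'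
      simp [hS, hp, hp', this]

lemma sum_powerset_second_difference {α : Type*} [DecidableEq α] (a : Finset α → ℝ)
    (S : Finset α) (e e' : α) :
    ∑ R ∈ S.powerset with e ∈ R ∧ e' ∈ R, a R =
      ∑ R ∈ S.powerset, a R + ∑ R ∈ ((S.erase e).erase e').powerset, a R
        - ∑ R ∈ (S.erase e).powerset, a R - ∑ R ∈ (S.erase e').powerset, a R := by
  have h1 : (S.erase e).powerset = S.powerset.filter fun R => e ∉ R := by
    ext R; simp [Finset.subset_erase]
  have h2 : (S.erase e').powerset = S.powerset.filter fun R => e' ∉ R := by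
    ext R; simp [Finset.subset_erase]
  have h3 : ((S.erase e).erase e').powerset = S.powerset.filter fun R => e ∉ R ∧ e' ∉ R := by
    ext R; simp [Finset.subset_erase, and_assoc]
  rw [h1, h2, h3]
  simp only [Finset.sum_filter]
  rw [← Finset.sum_add_distrib, ← Finset.sum_sub_distrib, ← Finset.sum_sub_distrib]
  refine Finset.sum_congr rfl fun R _ => ?_
  by_cases he : e ∈ R <;> by_cases he' : e' ∈ R <;> simp [he, he']

lemma coeff_eq_zero_of_induced_matching {n : ℕ} {A : Finset (Edge n) → ℝ}
    (hA : ∀ T : Finset (Edge n), ∑ S ∈ T.powerset, A S = if complHasPM T then 0 else 1)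
    {a a' b b' : Fin n} (S : Finset (Edge n))
    (h1 : (a, b) ∈ S) (h2 : (a', b') ∈ S) (h3 : (a, b') ∉ S) (h4 : (a', b) ∉ S) :
    A S = 0 := by
  induction S using Finset.strongInduction with
  | H S ih =>
    have h := sum_powerset_second_difference A S (a, b) (a', b')
    simp only [hA] at h
    rw [second_difference_eq_zero h1 h3 h4, add_sub_cancel_left, sub_self,
      Finset.sum_eq_single S] at h
    · exact h
    · intro R hR hne
      simp only [Finset.mem_filter, Finset.mem_powerset] at hR
      exact ih R (hR.1.ssubset_of_ne hne) hR.2.1 hR.2.2 (fun h => h3 (hR.1 h))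
        (fun h => h4 (hR.1 h))
    · intro hS
      simp [h1, h2] at hS

/-- The neighbourhood of the left vertex `i`. -/
def rowSet {n : ℕ} (S : Finset (Edge n)) (i : Fin n) : Finset (Fin n) :=
  univ.filter fun j => (i, j) ∈ S

/-- `S` is totally ordered: the neighbourhoods of the left vertices are nested. -/
def TotallyOrdered {n : ℕ} (S : Finset (Edge n)) : Prop :=
  ∀ i i' : Fin n, rowSet S i ⊆ rowSet S i' ∨ rowSet S i' ⊆ rowSet S i

lemma totallyOrdered_of_coeff_ne_zero {n : ℕ} {A : Finset (Edge n) → ℝ}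
    (hA : ∀ T : Finset (Edge n), ∑ S ∈ T.powerset, A S = if complHasPM T then 0 else 1)
    {S : Finset (Edge n)} (hS : A S ≠ 0) : TotallyOrdered S := by
  intro i i'
  by_contra! h
  rw [Finset.not_subset, Finset.not_subset] at h
  obtain ⟨⟨b, hb, hb'⟩, c, hc, hc'⟩ := h
  simp only [rowSet, Finset.mem_filter, Finset.mem_univ, true_and] at hb hb' hc hc'
  exact absurd (coeff_eq_zero_of_induced_matching hA S hb hc hc' hb') hS

/-- Maps `Fin n → B ∪ {0}` whose range contains `B`. -/
def pointedSurj (n : ℕ) (B : Finset ℕ) : Finset (Fin n → ℕ) :=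
  (Fintype.piFinset fun _ : Fin n => insert 0 B).filter fun g => ∀ v ∈ B, ∃ i, g i = v

lemma mem_pointedSurj {n : ℕ} {B : Finset ℕ} {g : Fin n → ℕ} :
    g ∈ pointedSurj n B ↔ (∀ i, g i = 0 ∨ g i ∈ B) ∧ ∀ v ∈ B, ∃ i, g i = v := by
  simp [pointedSurj]

lemma pointedSurj_succ_subset (n : ℕ) (B : Finset ℕ) :
    pointedSurj (n + 1) B ⊆
      ((insert 0 B ×ˢ pointedSurj n B) ∪
        B.biUnion fun v => {v} ×ˢ pointedSurj n (B.erase v)).image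
        fun p => (Fin.cons p.1 p.2 : Fin (n + 1) → ℕ) := by
  intro g hg
  rw [mem_pointedSurj] at hg
  refine Finset.mem_image.2 ⟨(g 0, Fin.tail g), ?_, Fin.cons_self_tail g⟩
  rw [Finset.mem_union]
  by_cases h : ∀ v ∈ B, ∃ i, Fin.tail g i = v
  · left
    simp only [Finset.mem_product, mem_pointedSurj, Finset.mem_insert]
    exact ⟨hg.1 0, fun i => hg.1 i.succ, h⟩
  · right
    push Not at h
    obtain ⟨v, hv, hne⟩ := h
    have h0 : g 0 = v := by
      obtain ⟨i, hi⟩ := hg.2 v hv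
      induction i using Fin.cases with
      | zero => exact hi
      | succ i => exact absurd hi (hne i)
    simp only [Finset.mem_biUnion, Finset.mem_product, Finset.mem_singleton, mem_pointedSurj,
      Finset.mem_erase]
    refine ⟨v, hv, h0, fun i => (hg.1 i.succ).imp id fun h => ⟨hne i, h⟩, ?_⟩
    rintro u ⟨huv, hu⟩
    obtain ⟨i, hi⟩ := hg.2 u hu
    induction i using Fin.cases with
    | zero => exact absurd (hi.symm.trans h0) huv
    | succ i => exact ⟨i, hi⟩

lemma factorial_mul_stirling2_succ_zero (n : ℕ) :
    Nat.factorial 0 * stirling2 (n + 2) 1 = Nat.factorial 0 * stirling2 (n + 1) 1 := by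
  simp [stirling2]

lemma factorial_mul_stirling2_succ_succ (n j : ℕ) :
    Nat.factorial (j + 1) * stirling2 (n + 2) (j + 2) =
      (j + 2) * (Nat.factorial (j + 1) * stirling2 (n + 1) (j + 2)) +
        (j + 1) * (Nat.factorial j * stirling2 (n + 1) (j + 1)) := by
  rw [show stirling2 (n + 2) (j + 2) =
    (j + 1 + 1) * stirling2 (n + 1) (j + 2) + stirling2 (n + 1) (j + 1) from by
      rw [stirling2], Nat.factorial_succ]
  ring

lemma card_pointedSurj_le (n : ℕ) (B : Finset ℕ) :
    (pointedSurj n B).card ≤ Nat.factorial B.card * stirling2 (n + 1) (B.card + 1) := by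
  induction n generalizing B with
  | zero =>
    rcases B.eq_empty_or_nonempty with rfl | ⟨v, hv⟩
    · refine (Finset.card_le_one_of_subsingleton _).trans ?_
      simp [stirling2]
    · have : pointedSurj 0 B = ∅ := by
        refine Finset.eq_empty_of_forall_notMem fun g hg => ?_
        obtain ⟨i, -⟩ := (mem_pointedSurj.1 hg).2 v hv
        exact i.elim0
      simp [this]
  | succ n ih =>
    refine (Finset.card_le_card (pointedSurj_succ_subset n B)).trans
      (Finset.card_image_le.trans ((Finset.card_union_le _ _).trans ?_))
    have h1 : (insert 0 B ×ˢ pointedSurj n B).card ≤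
        (B.card + 1) * (Nat.factorial B.card * stirling2 (n + 1) (B.card + 1)) := by
      rw [Finset.card_product]
      exact Nat.mul_le_mul (Finset.card_insert_le _ _) (ih B)
    rcases hB : B.card with _ | j
    · rw [Finset.card_eq_zero] at hB
      subst hB
      rw [factorial_mul_stirling2_succ_zero]
      simpa using h1
    · have h2 : (B.biUnion fun v => {v} ×ˢ pointedSurj n (B.erase v)).card ≤
          (j + 1) * (Nat.factorial j * stirling2 (n + 1) (j + 1)) := by
        have h := Finset.card_biUnion_le_card_mul B (fun v => {v} ×ˢ pointedSurj n (B.erase v))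
          (Nat.factorial j * stirling2 (n + 1) (j + 1)) fun v hv => by
            have h := ih (B.erase v)
            rw [Finset.card_erase_of_mem hv, hB, Nat.add_sub_cancel] at h
            simpa [Finset.card_product] using h
        rwa [hB] at h
      rw [factorial_mul_stirling2_succ_succ]
      rw [hB] at h1
      exact Nat.add_le_add h1 h2

/-- The threshold graph with row levels `r`, column levels `c` and threshold `j`. -/
def levelGraph {n : ℕ} (j : ℕ) (r c : Fin n → ℕ) : Finset (Edge n) :=
  univ.filter fun e => j < r e.1 + c e.2

lemma exists_eq_of_injOn_Icc {α : Type*} {s : Finset α} {f : α → ℕ}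
    (hf : ∀ x ∈ s, f x ∈ Finset.Icc 1 s.card) (hinj : Set.InjOn f s) {v : ℕ}
    (hv : v ∈ Finset.Icc 1 s.card) : ∃ x ∈ s, f x = v := by
  have := Finset.surjOn_of_injOn_of_card_le f hf hinj (by simp)
  simpa using this hv

lemma exists_card_filter_subset_eq {α : Type*} [DecidableEq α] {Q : Finset (Finset α)}
    (htot : ∀ R ∈ Q, ∀ R' ∈ Q, R ⊆ R' ∨ R' ⊆ R) {v : ℕ} (hv : v ∈ Finset.Icc 1 Q.card) :
    ∃ R ∈ Q, (Q.filter fun T => T ⊆ R).card = v := by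
  refine exists_eq_of_injOn_Icc (fun R hR => ?_) (fun R hR R' hR' hRR' => ?_) hv
  · exact Finset.mem_Icc.2 ⟨Finset.card_pos.2 ⟨R, by simpa using hR⟩, Finset.card_filter_le _ _⟩
  · have key : ∀ R ∈ Q, ∀ R' ∈ Q, R ⊆ R' →
        (Q.filter fun T => T ⊆ R).card = (Q.filter fun T => T ⊆ R').card → R' ⊆ R := by
      intro R _ R' hR' hsub hc
      have := Finset.eq_of_subset_of_card_le
        (Finset.monotone_filter_right Q fun T _ (hT : T ⊆ R) => hT.trans hsub) hc.ge
      have hm : R' ∈ Q.filter fun T => T ⊆ R := by rw [this]; simp [hR']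
      exact (Finset.mem_filter.1 hm).2
    rcases htot R hR R' hR' with h | h
    · exact h.antisymm (key R hR R' hR' h hRR')
    · exact (key R' hR' R hR h hRR'.symm).antisymm h

lemma exists_card_filter_superset_eq {α : Type*} [DecidableEq α] {Q : Finset (Finset α)}
    (htot : ∀ R ∈ Q, ∀ R' ∈ Q, R ⊆ R' ∨ R' ⊆ R) {v : ℕ} (hv : v ∈ Finset.Icc 1 Q.card) :
    ∃ R ∈ Q, (Q.filter fun T => R ⊆ T).card = v := by
  refine exists_eq_of_injOn_Icc (fun R hR => ?_) (fun R hR R' hR' hRR' => ?_) hv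
  · exact Finset.mem_Icc.2 ⟨Finset.card_pos.2 ⟨R, by simpa using hR⟩, Finset.card_filter_le _ _⟩
  · have key : ∀ R ∈ Q, ∀ R' ∈ Q, R ⊆ R' →
        (Q.filter fun T => R ⊆ T).card = (Q.filter fun T => R' ⊆ T).card → R' ⊆ R := by
      intro R hR R' _ hsub hc
      have := Finset.eq_of_subset_of_card_le
        (Finset.monotone_filter_right Q fun T _ (hT : R' ⊆ T) => hsub.trans hT) hc.le
      have hm : R ∈ Q.filter fun T => R' ⊆ T := by rw [this]; simp [hR]
      exact (Finset.mem_filter.1 hm).2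
    rcases htot R hR R' hR' with h | h
    · exact h.antisymm (key R hR R' hR' h hRR')
    · exact (key R' hR' R hR h hRR'.symm).antisymm h

/-- In a chain of finite sets, every nonempty member has an element in no smaller member. -/
lemma exists_mem_forall_mem_subset {α : Type*} {Q : Finset (Finset α)}
    (htot : ∀ R ∈ Q, ∀ R' ∈ Q, R ⊆ R' ∨ R' ⊆ R) {R : Finset α} (hR : R.Nonempty) :
    ∃ q ∈ R, ∀ R' ∈ Q, q ∈ R' → R ⊆ R' := by
  by_contra! hcon
  obtain ⟨q₀, hq₀⟩ := hR
  obtain ⟨R₀, hR₀, -, hnR₀⟩ := hcon q₀ hq₀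
  obtain ⟨M, hM, hmax⟩ := Finset.exists_max_image (Q.filter fun T => ¬ R ⊆ T)
    Finset.card ⟨R₀, by simp [hR₀, hnR₀]⟩
  rw [Finset.mem_filter] at hM
  refine hM.2 fun q hq => ?_
  obtain ⟨R', hR', hqR', hnR'⟩ := hcon q hq
  have hc := hmax R' (by simp [hR', hnR'])
  rcases htot R' hR' M hM.1 with h | h
  · exact h hqR'
  · rwa [Finset.eq_of_subset_of_card_le h hc]

lemma TotallyOrdered.exists_levelGraph {n : ℕ} {S : Finset (Edge n)} (hS : TotallyOrdered S) :
    ∃ j ≤ n, ∃ r ∈ pointedSurj n (Finset.Icc 1 j), ∃ c ∈ pointedSurj n (Finset.Icc 1 j),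
      levelGraph j r c = S := by
  set Q : Finset (Finset (Fin n)) := (univ.image (rowSet S)).erase ∅ with hQ
  have hmem : ∀ {R}, R ∈ Q ↔ R ≠ ∅ ∧ ∃ i, rowSet S i = R := by
    intro R; simp [hQ]
  have htot : ∀ R ∈ Q, ∀ R' ∈ Q, R ⊆ R' ∨ R' ⊆ R := by
    intro R hR R' hR'
    obtain ⟨-, i, rfl⟩ := hmem.1 hR
    obtain ⟨-, i', rfl⟩ := hmem.1 hR'
    exact hS i i'
  have hlevel : ∀ m ≤ Q.card, m = 0 ∨ m ∈ Finset.Icc 1 Q.card := by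
    intro m hm
    rw [Finset.mem_Icc]
    omega
  refine ⟨Q.card, ?_, fun i => (Q.filter fun R => R ⊆ rowSet S i).card, ?_,
    fun q => (Q.filter fun R => q ∈ R).card, ?_, ?_⟩
  · exact (Finset.card_erase_le).trans (Finset.card_image_le.trans (by simp))
  · refine mem_pointedSurj.2
      ⟨fun i => hlevel _ (Finset.card_filter_le _ _), fun v hv => ?_⟩
    obtain ⟨R, hR, hRv⟩ := exists_card_filter_subset_eq htot hv
    obtain ⟨-, i, rfl⟩ := hmem.1 hR
    exact ⟨i, hRv⟩
  · refine mem_pointedSurj.2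
      ⟨fun q => hlevel _ (Finset.card_filter_le _ _), fun v hv => ?_⟩
    obtain ⟨R, hR, hRv⟩ := exists_card_filter_superset_eq htot hv
    obtain ⟨q, hqR, hq⟩ :=
      exists_mem_forall_mem_subset htot (Finset.nonempty_iff_ne_empty.2 (hmem.1 hR).1)
    refine ⟨q, ?_⟩
    rw [← hRv]
    exact congrArg Finset.card
      (Finset.filter_congr fun R' hR' => ⟨hq R' hR', fun h => h hqR⟩)
  · ext ⟨i, q⟩
    have hiq : (i, q) ∈ S ↔ q ∈ rowSet S i := by simp [rowSet]
    simp only [levelGraph, Finset.mem_filter, Finset.mem_univ, true_and, hiq]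
    have hsum := Finset.card_union_add_card_inter (Q.filter fun R => R ⊆ rowSet S i)
      (Q.filter fun R => q ∈ R)
    constructor
    · intro hlt
      by_contra hq
      have hU : ((Q.filter fun R => R ⊆ rowSet S i) ∪ Q.filter fun R => q ∈ R).card ≤ Q.card := by
        rw [← Finset.filter_or]; exact Finset.card_filter_le _ _
      have hI : ((Q.filter fun R => R ⊆ rowSet S i) ∩ Q.filter fun R => q ∈ R) = ∅ := by
        refine Finset.eq_empty_of_forall_notMem fun R hR => ?_
        simp only [Finset.mem_inter, Finset.mem_filter] at hR
        exact hq (hR.1.2 hR.2.2)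
      rw [hI, Finset.card_empty] at hsum
      omega
    · intro hq
      have hi : rowSet S i ∈ Q := hmem.2 ⟨Finset.ne_empty_of_mem hq, i, rfl⟩
      have hU : ((Q.filter fun R => R ⊆ rowSet S i) ∪ Q.filter fun R => q ∈ R) = Q := by
        rw [← Finset.filter_or, Finset.filter_true_of_mem]
        exact fun R hR => (htot R hR _ hi).imp id fun h => h hq
      have hI : 0 < ((Q.filter fun R => R ⊆ rowSet S i) ∩ Q.filter fun R => q ∈ R).card :=
        Finset.card_pos.2 ⟨rowSet S i, by simp [hi, hq]⟩
      rw [hU] at hsum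
      omega

lemma card_totallyOrdered_le (n : ℕ) :
    (univ.filter fun S : Finset (Edge n) => TotallyOrdered S).card ≤
      ∑ j ∈ Finset.range (n + 1), (Nat.factorial j * stirling2 (n + 1) (j + 1)) ^ 2 := by
  have hsub : (univ.filter fun S : Finset (Edge n) => TotallyOrdered S) ⊆
      (Finset.range (n + 1)).biUnion fun j =>
        (pointedSurj n (Finset.Icc 1 j) ×ˢ pointedSurj n (Finset.Icc 1 j)).image
          fun p => levelGraph j p.1 p.2 := by
    intro S hS
    obtain ⟨j, hj, r, hr, c, hc, h⟩ := (Finset.mem_filter.1 hS).2.exists_levelGraph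
    exact Finset.mem_biUnion.2 ⟨j, Finset.mem_range.2 (Nat.lt_succ_of_le hj),
      Finset.mem_image.2 ⟨(r, c), Finset.mem_product.2 ⟨hr, hc⟩, h⟩⟩
  refine (Finset.card_le_card hsub).trans (Finset.card_biUnion_le.trans
    (Finset.sum_le_sum fun j _ => Finset.card_image_le.trans ?_))
  rw [Finset.card_product, sq]
  have h := card_pointedSurj_le n (Finset.Icc 1 j)
  rw [Nat.card_Icc, Nat.add_sub_cancel] at h
  exact Nat.mul_le_mul h h

/-- The strictly totally ordered graph given by orderings of both sides. -/
def staircase {n : ℕ} (σ τ : Equiv.Perm (Fin n)) : Finset (Edge n) :=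
  univ.filter fun e => (σ e.1 : ℕ) + τ e.2 < n

/-- The `k`-th maximal complete bipartite subgraph of the staircase. -/
def block {n : ℕ} (σ τ : Equiv.Perm (Fin n)) (k : Fin n) : Finset (Edge n) :=
  univ.filter fun e => σ e.1 ≤ k ∧ (k : ℕ) + τ e.2 < n

lemma mem_staircase {n : ℕ} {σ τ : Equiv.Perm (Fin n)} {e : Edge n} :
    e ∈ staircase σ τ ↔ (σ e.1 : ℕ) + τ e.2 < n := by simp [staircase]

lemma mem_block {n : ℕ} {σ τ : Equiv.Perm (Fin n)} {k : Fin n} {e : Edge n} :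
    e ∈ block σ τ k ↔ σ e.1 ≤ k ∧ (k : ℕ) + τ e.2 < n := by simp [block]

lemma card_filter_perm {n : ℕ} (τ : Equiv.Perm (Fin n)) (p : Fin n → Prop) [DecidablePred p] :
    (univ.filter fun j => p (τ j)).card = (univ.filter p).card := by
  refine Finset.card_bij (fun j _ => τ j) (by simp) (fun _ _ _ _ h => τ.injective h) ?_
  intro j hj
  exact ⟨τ.symm j, by simpa using hj, by simp⟩

lemma card_filter_add_lt {n : ℕ} (τ : Equiv.Perm (Fin n)) (k : Fin n) :
    (univ.filter fun j => (k : ℕ) + τ j < n).card = n - k := by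
  rw [card_filter_perm τ (fun j : Fin n => (k : ℕ) + j < n)]
  have h : ∀ j : Fin n, (k : ℕ) + j < n ↔ (j : ℕ) < n - k := by intro j; omega
  rw [Finset.filter_congr fun j _ => h j, Fin.card_filter_val_lt]
  omega

lemma card_filter_perm_le {n : ℕ} (σ : Equiv.Perm (Fin n)) (k : Fin n) :
    (univ.filter fun i => σ i ≤ k).card = k + 1 := by
  rw [card_filter_perm σ (fun i : Fin n => i ≤ k)]
  have h : ∀ i : Fin n, i ≤ k ↔ (i : ℕ) < k + 1 := fun i => by rw [Fin.le_def]; omega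
  rw [Finset.filter_congr fun i _ => h i, Fin.card_filter_val_lt]
  omega

lemma complHasPM_iff_of_subset_staircase {n : ℕ} {σ τ : Equiv.Perm (Fin n)}
    {T : Finset (Edge n)} (hT : T ⊆ staircase σ τ) :
    complHasPM T ↔ ∀ k, ¬ block σ τ k ⊆ T := by
  constructor
  · intro h k hk
    refine not_complHasPM_of_card_lt (univ.filter fun i => σ i ≤ k) ?_ h
    rw [card_filter_perm_le]
    have hsub : (univ.filter fun j => ∃ i ∈ univ.filter (fun i => σ i ≤ k), (i, j) ∉ T) ⊆
        (univ.filter fun j => (k : ℕ) + τ j < n)ᶜ := by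
      intro j hj
      simp only [Finset.mem_filter, Finset.mem_univ, true_and, Finset.mem_compl] at hj ⊢
      obtain ⟨i, hi, hij⟩ := hj
      exact fun hlt => hij (hk (mem_block.2 ⟨hi, hlt⟩))
    refine (Finset.card_le_card hsub).trans_lt ?_
    rw [Finset.card_compl, card_filter_add_lt, Fintype.card_fin]
    omega
  · intro h
    by_contra hPM
    obtain ⟨X, hX⟩ := exists_card_lt_of_not_complHasPM hPM
    set N := univ.filter fun j => ∃ i ∈ X, (i, j) ∉ T with hN
    have hNT : ∀ i ∈ X, ∀ j ∈ Nᶜ, (i, j) ∈ T := by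
      intro i hi j hj
      by_contra hij
      exact Finset.mem_compl.1 hj (by rw [hN]; simpa using ⟨i, hi, hij⟩)
    obtain ⟨m, hm, hmax⟩ := Finset.exists_max_image X σ (Finset.card_pos.1 (by omega))
    have hX1 : X ⊆ univ.filter fun i => σ i ≤ σ m := fun i hi => by simpa using hmax i hi
    have hN1 : Nᶜ ⊆ univ.filter fun j => (σ m : ℕ) + τ j < n := fun j hj => by
      simpa using mem_staircase.1 (hT (hNT m hm j hj))
    have hc1 := Finset.card_le_card hX1
    have hc2 := Finset.card_le_card hN1
    have hc3 := N.card_le_univ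
    have hc4 := Finset.card_compl N
    have hlt := (σ m).2
    rw [card_filter_perm_le] at hc1
    rw [card_filter_add_lt] at hc2
    rw [Fintype.card_fin] at hc3 hc4
    have hX2 := Finset.eq_of_subset_of_card_le hX1 (by rw [card_filter_perm_le]; omega)
    have hN2 := Finset.eq_of_subset_of_card_le hN1 (by rw [card_filter_add_lt]; omega)
    refine h (σ m) fun e he => ?_
    rw [mem_block] at he
    refine hNT e.1 ?_ e.2 ?_
    · rw [hX2]; simpa using he.1
    · rw [hN2]; simpa using he.2

lemma eq_of_forall_sum_powerset_eq {α : Type*} [DecidableEq α] {a b : Finset α → ℝ} {S : Finset α}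
    (h : ∀ T ⊆ S, ∑ R ∈ T.powerset, a R = ∑ R ∈ T.powerset, b R) : a S = b S := by
  induction S using Finset.strongInduction with
  | H S ih =>
    have hS := h S subset_rfl
    rw [← Finset.insert_erase (Finset.mem_powerset_self S),
      Finset.sum_insert (Finset.notMem_erase _ _), Finset.sum_insert (Finset.notMem_erase _ _)] at hS
    rw [Finset.sum_congr rfl (g := b)] at hS
    · exact add_right_cancel hS
    · intro R hR
      rw [Finset.mem_erase, Finset.mem_powerset] at hR
      exact ih R (hR.2.ssubset_of_ne hR.1) fun T hT => h T (hT.trans hR.2)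

lemma sum_nonempty_powerset_neg_one_pow {α : Type*} [DecidableEq α] (s : Finset α) :
    ∑ K ∈ s.powerset with K.Nonempty, (-1 : ℝ) ^ (K.card + 1) =
      if s.Nonempty then 1 else 0 := by
  have h0 : ∑ K ∈ s.powerset, (-1 : ℝ) ^ K.card = if s = ∅ then 1 else 0 := by
    exact_mod_cast congrArg (Int.cast : ℤ → ℝ) (Finset.sum_powerset_neg_one_pow_card (x := s))
  have h1 : s.powerset.filter (fun K => K.Nonempty) = s.powerset.erase ∅ := by
    ext K
    simp [Finset.nonempty_iff_ne_empty, and_comm]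
  rw [← Finset.insert_erase (Finset.empty_mem_powerset s),
    Finset.sum_insert (Finset.notMem_erase _ _)] at h0
  rw [h1]
  simp only [pow_succ, mul_neg_one, Finset.sum_neg_distrib, Finset.nonempty_iff_ne_empty, ite_not]
  rw [Finset.card_empty, pow_zero] at h0
  split_ifs at h0 ⊢ <;> linarith

/-- The multilinear coefficients given by inclusion-exclusion over the blocks. -/
def blockCoeff {n : ℕ} (σ τ : Equiv.Perm (Fin n)) (R : Finset (Edge n)) : ℝ :=
  ∑ K : Finset (Fin n) with K.Nonempty ∧ K.biUnion (block σ τ) = R, (-1) ^ (K.card + 1)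

lemma sum_powerset_blockCoeff {n : ℕ} (σ τ : Equiv.Perm (Fin n)) (T : Finset (Edge n)) :
    ∑ R ∈ T.powerset, blockCoeff σ τ R = if ∀ k, ¬ block σ τ k ⊆ T then 0 else 1 := by
  have h := sum_nonempty_powerset_neg_one_pow (univ.filter fun k => block σ τ k ⊆ T)
  have h1 : (if (univ.filter fun k => block σ τ k ⊆ T).Nonempty then (1 : ℝ) else 0) =
      if ∀ k, ¬ block σ τ k ⊆ T then 0 else 1 := by
    rw [← ite_not]
    refine if_congr ?_ rfl rfl
    simp [Finset.filter_eq_empty_iff]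
  rw [← h1, ← h]
  simp only [blockCoeff, Finset.sum_filter]
  rw [Finset.sum_comm, ← Finset.sum_subset (Finset.subset_univ
    (univ.filter fun k => block σ τ k ⊆ T).powerset)]
  · refine Finset.sum_congr rfl fun K hK => ?_
    have hKT : K.biUnion (block σ τ) ∈ T.powerset := by
      rw [Finset.mem_powerset, Finset.biUnion_subset]
      intro k hk
      simpa using Finset.mem_powerset.1 hK hk
    rw [Finset.sum_eq_single_of_mem _ hKT fun R _ hR => by simp [hR.symm]]
    simp
  · intro K _ hK
    refine Finset.sum_eq_zero fun R hR => if_neg ?_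
    rintro ⟨-, rfl⟩
    refine hK (Finset.mem_powerset.2 fun k hk => ?_)
    simpa using (Finset.subset_biUnion_of_mem _ hk).trans (Finset.mem_powerset.1 hR)

lemma biUnion_block_eq_staircase_iff {n : ℕ} {σ τ : Equiv.Perm (Fin n)} {K : Finset (Fin n)} :
    K.biUnion (block σ τ) = staircase σ τ ↔ K = univ := by
  constructor
  · intro h
    refine Finset.eq_univ_of_forall fun k => ?_
    have hmem : (σ.symm k, τ.symm k.rev) ∈ staircase σ τ := by
      rw [mem_staircase]
      simp [Fin.val_rev]
      omega
    rw [← h, Finset.mem_biUnion] at hmem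
    obtain ⟨l, hl, hkl⟩ := hmem
    rw [mem_block] at hkl
    simp only [Equiv.apply_symm_apply, Fin.val_rev, Fin.le_def] at hkl
    have : k = l := Fin.ext (by omega)
    rwa [this]
  · rintro rfl
    ext e
    simp only [Finset.mem_biUnion, Finset.mem_univ, true_and, mem_block, mem_staircase]
    constructor
    · rintro ⟨k, hk, hlt⟩
      rw [Fin.le_def] at hk
      omega
    · exact fun h => ⟨σ e.1, le_rfl, h⟩

lemma coeff_staircase {n : ℕ} (hn : 0 < n) {A : Finset (Edge n) → ℝ}
    (hA : ∀ T : Finset (Edge n), ∑ S ∈ T.powerset, A S = if complHasPM T then 0 else 1)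
    (σ τ : Equiv.Perm (Fin n)) : A (staircase σ τ) = (-1) ^ (n + 1) := by
  rw [eq_of_forall_sum_powerset_eq (a := A) (b := blockCoeff σ τ) (S := staircase σ τ)]
  · have : (univ.filter fun K : Finset (Fin n) =>
        K.Nonempty ∧ K.biUnion (block σ τ) = staircase σ τ) = {univ} := by
      ext K
      simp only [biUnion_block_eq_staircase_iff, Finset.mem_filter, Finset.mem_univ, true_and,
        Finset.mem_singleton, and_iff_right_iff_imp]
      rintro rfl
      exact ⟨⟨0, hn⟩, Finset.mem_univ _⟩
    rw [blockCoeff, this]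
    simp
  · intro T hT
    rw [hA, sum_powerset_blockCoeff]
    exact if_congr (complHasPM_iff_of_subset_staircase hT) rfl rfl

lemma staircase_injective (n : ℕ) :
    Function.Injective fun p : Equiv.Perm (Fin n) × Equiv.Perm (Fin n) => staircase p.1 p.2 := by
  rintro ⟨σ, τ⟩ ⟨σ', τ'⟩ h
  have hmem : ∀ i j, (σ i : ℕ) + τ j < n ↔ (σ' i : ℕ) + τ' j < n := by
    intro i j
    have := congrArg (fun S => (i, j) ∈ S) h
    simpa [mem_staircase] using this
  refine Prod.ext (Equiv.ext fun i => Fin.ext ?_) (Equiv.ext fun j => Fin.ext ?_)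
  · have h1 := card_filter_add_lt τ (σ i)
    rw [Finset.filter_congr fun j _ => hmem i j, card_filter_add_lt] at h1
    have := (σ i).2
    have := (σ' i).2
    simp only
    omega
  · have h1 := card_filter_add_lt σ (τ j)
    rw [Finset.filter_congr fun i _ => (by rw [add_comm, hmem i j, add_comm] :
      (τ j : ℕ) + σ i < n ↔ (τ' j : ℕ) + σ' i < n), card_filter_add_lt] at h1
    have := (τ j).2
    have := (τ' j).2
    simp only
    omega

lemma factorial_sq_le_card_coeff_ne_zero {n : ℕ} (hn : 0 < n) {A : Finset (Edge n) → ℝ}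
    (hA : ∀ T : Finset (Edge n), ∑ S ∈ T.powerset, A S = if complHasPM T then 0 else 1) :
    (Nat.factorial n) ^ 2 ≤ (univ.filter fun S : Finset (Edge n) => A S ≠ 0).card := by
  have hcard : (univ : Finset (Equiv.Perm (Fin n) × Equiv.Perm (Fin n))).card =
      (Nat.factorial n) ^ 2 := by
    rw [Finset.card_univ, Fintype.card_prod, Fintype.card_perm, Fintype.card_fin, sq]
  rw [← hcard]
  refine Finset.card_le_card_of_injOn (fun p => staircase p.1 p.2) (fun p _ => ?_)
    (staircase_injective n).injOn
  simp [coeff_staircase hn hA]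

lemma stirling2_eq_zero_of_lt {n k : ℕ} (h : n < k) : stirling2 n k = 0 := by
  induction n generalizing k with
  | zero => obtain ⟨k, rfl⟩ := Nat.exists_eq_succ_of_ne_zero h.ne'; rfl
  | succ n ih =>
    obtain ⟨k, rfl⟩ := Nat.exists_eq_succ_of_ne_zero (Nat.ne_zero_of_lt h)
    rw [stirling2, ih (by omega), ih (by omega), mul_zero]

lemma two_mul_pow_le_succ_pow {m : ℕ} (hm : 0 < m) : 2 * m ^ m ≤ (m + 1) ^ m := by
  obtain ⟨k, rfl⟩ := Nat.exists_eq_succ_of_ne_zero hm.ne'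
  rw [Nat.succ_eq_add_one, add_pow (k + 1) 1 (k + 1), Finset.sum_range_succ, Finset.sum_range_succ]
  simp
  have : (k + 1) ^ k * (k + 1) = (k + 1) ^ (k + 1) := (pow_succ _ _).symm
  omega

lemma sum_factorial_mul_stirling2_le (n : ℕ) :
    ∑ j ∈ Finset.range (n + 1), Nat.factorial j * stirling2 (n + 1) (j + 1) ≤ (n + 1) ^ n := by
  induction n with
  | zero => simp [stirling2]
  | succ n ih =>
    set w : ℕ → ℕ := fun j => Nat.factorial j * stirling2 (n + 1) (j + 1) with hw
    have hw0 : w (n + 1) = 0 := by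
      simp only [hw]; rw [stirling2_eq_zero_of_lt (by omega), mul_zero]
    have h1 : ∑ j ∈ Finset.range (n + 2), Nat.factorial j * stirling2 (n + 2) (j + 1) =
        ∑ j ∈ Finset.range (n + 1), (2 * (j + 1)) * w j := by
      rw [Finset.sum_range_succ']
      have h2 : ∀ j, Nat.factorial (j + 1) * stirling2 (n + 2) (j + 1 + 1) =
          (j + 1 + 1) * w (j + 1) + (j + 1) * w j := factorial_mul_stirling2_succ_succ n
      have h3 : Nat.factorial 0 * stirling2 (n + 2) (0 + 1) = (0 + 1) * w 0 := by
        rw [zero_add, one_mul]; exact factorial_mul_stirling2_succ_zero n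
      rw [Finset.sum_congr rfl fun j _ => h2 j, h3, Finset.sum_add_distrib, add_right_comm,
        ← Finset.sum_range_succ' (fun j => (j + 1) * w j), Finset.sum_range_succ, hw0, mul_zero,
        add_zero, ← Finset.sum_add_distrib]
      exact Finset.sum_congr rfl fun j _ => by ring
    calc _ = ∑ j ∈ Finset.range (n + 1), (2 * (j + 1)) * w j := h1
      _ ≤ ∑ j ∈ Finset.range (n + 1), (2 * (n + 1)) * w j := by
        refine Finset.sum_le_sum fun j hj => Nat.mul_le_mul_right _ ?_
        have := Finset.mem_range.1 hj
        omega
      _ ≤ 2 * (n + 1) * (n + 1) ^ n := by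
        rw [← Finset.mul_sum]
        exact Nat.mul_le_mul_left _ ih
      _ = 2 * (n + 1) ^ (n + 1) := by ring
      _ ≤ (n + 1 + 1) ^ (n + 1) := two_mul_pow_le_succ_pow n.succ_pos

lemma sum_sq_le_sq_sum_nat {ι : Type*} (s : Finset ι) (f : ι → ℕ) :
    ∑ i ∈ s, f i ^ 2 ≤ (∑ i ∈ s, f i) ^ 2 := by
  rw [sq (∑ i ∈ s, f i), Finset.sum_mul]
  refine Finset.sum_le_sum fun i hi => ?_
  rw [sq]
  exact Nat.mul_le_mul_left _ (Finset.single_le_sum (fun _ _ => Nat.zero_le _) hi)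

lemma sum_factorial_mul_stirling2_sq_lt (n : ℕ) :
    ∑ j ∈ Finset.range (n + 1), (Nat.factorial j * stirling2 (n + 1) (j + 1)) ^ 2
      < (n + 2) ^ (2 * n + 2) := by
  calc _ ≤ (∑ j ∈ Finset.range (n + 1), Nat.factorial j * stirling2 (n + 1) (j + 1)) ^ 2 :=
        sum_sq_le_sq_sum_nat _ _
    _ ≤ ((n + 1) ^ n) ^ 2 := Nat.pow_le_pow_left (sum_factorial_mul_stirling2_le n) 2
    _ ≤ (n + 2) ^ (2 * n) := by
        rw [← pow_mul, mul_comm]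
        exact Nat.pow_le_pow_left (by omega) _
    _ < (n + 2) ^ (2 * n + 2) := Nat.pow_lt_pow_right (by omega) (by omega)

lemma sum_Icc_eq_sum_range_stirling2 (n : ℕ) :
    ∑ k ∈ Finset.Icc 1 (n + 1), (Nat.factorial (k - 1) * stirling2 (n + 1) k) ^ 2 =
      ∑ j ∈ Finset.range (n + 1), (Nat.factorial j * stirling2 (n + 1) (j + 1)) ^ 2 := by
  rw [← Finset.Ico_add_one_right_eq_Icc, Finset.sum_Ico_eq_sum_range]
  refine Finset.sum_congr (by simp) fun j _ => ?_
  rw [Nat.add_sub_cancel_left, add_comm 1 j]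

lemma eventually_logb_bounds {M : ℕ → ℕ}
    (hM : ∀ n, 1 < n → (Nat.factorial n) ^ 2 ≤ M n ∧ M n < (n + 2) ^ (2 * n + 2)) :
    ∃ c₁ c₂ : ℝ, 0 < c₁ ∧ 0 < c₂ ∧ ∀ᶠ n : ℕ in Filter.atTop,
      c₁ * ((n : ℝ) * Real.log n) ≤ Real.logb 2 (M n) ∧
      Real.logb 2 (M n) ≤ c₂ * ((n : ℝ) * Real.log n) := by
  have hlog2 : 0 < Real.log 2 := Real.log_pos one_lt_two
  refine ⟨1 / Real.log 2, 8 / Real.log 2, by positivity, by positivity, ?_⟩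
  have hlarge : ∀ᶠ n : ℕ in Filter.atTop, 2 ≤ Real.log n :=
    (Real.tendsto_log_atTop.comp tendsto_natCast_atTop_atTop).eventually_ge_atTop 2
  filter_upwards [hlarge, Filter.eventually_ge_atTop 2] with n hlog hn
  obtain ⟨hlow, hup⟩ := hM n hn
  have hn' : (2 : ℝ) ≤ n := by exact_mod_cast hn
  have hn0 : (0 : ℝ) < n := by linarith
  have hfpos : (0 : ℝ) < (Nat.factorial n : ℝ) := by exact_mod_cast Nat.factorial_pos n
  have hMpos : (0 : ℝ) < M n := by
    exact_mod_cast (pow_pos (Nat.factorial_pos n) 2).trans_le hlow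
  have h1 : (n : ℝ) * Real.log n - n ≤ Real.log (Nat.factorial n) := by
    have h := Real.pow_div_factorial_le_exp (n : ℝ) hn0.le n
    have h' := Real.log_le_log (by positivity) h
    rw [Real.log_exp, Real.log_div (by positivity) hfpos.ne', Real.log_pow] at h'
    linarith
  have h2 : 2 * Real.log (Nat.factorial n) ≤ Real.log (M n) := by
    have h : ((Nat.factorial n : ℝ)) ^ 2 ≤ M n := by exact_mod_cast hlow
    have h' := Real.log_le_log (by positivity) h
    rw [Real.log_pow] at h'
    exact_mod_cast h'
  have h3 : Real.log (M n) ≤ (2 * n + 2) * Real.log (n + 2) := by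
    have h : (M n : ℝ) ≤ ((n : ℝ) + 2) ^ (2 * n + 2) := by exact_mod_cast hup.le
    have h' := Real.log_le_log hMpos h
    rw [Real.log_pow] at h'
    exact_mod_cast h'
  have h4 : Real.log ((n : ℝ) + 2) ≤ 2 * Real.log n := by
    have h : (n : ℝ) + 2 ≤ (n : ℝ) ^ 2 := by nlinarith
    have h' := Real.log_le_log (by positivity) h
    rw [Real.log_pow] at h'
    exact_mod_cast h'
  rw [Real.logb, div_mul_eq_mul_div, div_mul_eq_mul_div]
  constructor
  · refine div_le_div_of_nonneg_right ?_ hlog2.le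
    nlinarith
  · refine div_le_div_of_nonneg_right ?_ hlog2.le
    calc Real.log (M n) ≤ (2 * n + 2) * Real.log (n + 2) := h3
      _ ≤ (2 * n + 2) * (2 * Real.log n) := by gcongr
      _ ≤ (4 * n) * (2 * Real.log n) := by gcongr; linarith
      _ = 8 * (n * Real.log n) := by ring

/-- for any family of real multilinear representations of the dual functions
`BPM*_n(x) = 1 − BPM_n(1−x)`, the number `M n` of monomials with nonzero coefficient
satisfies, for every `n > 1`,
`(n!)² ≤ M n ≤ ∑_{k=1}^{n+1} ((k−1)!·S(n+1,k))² < (n+2)^{2n+2}`;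
in particular `log₂ (M n) = Θ(n log n)`. -/
theorem stmt19 (A : (n : ℕ) → Finset (Edge n) → ℝ)
    (hA : ∀ (n : ℕ) (x : Edge n → Bool),
      (∑ S : Finset (Edge n), A n S * ∏ e ∈ S, (if x e then (1 : ℝ) else 0))
        = (if BPMb n (fun e => ! x e) then 0 else 1)) :
    (∀ n : ℕ, 1 < n →
      (Nat.factorial n) ^ 2
          ≤ (Finset.univ.filter fun S : Finset (Edge n) => A n S ≠ 0).card ∧
      (Finset.univ.filter fun S : Finset (Edge n) => A n S ≠ 0).card
          ≤ ∑ k ∈ Finset.Icc 1 (n + 1), (Nat.factorial (k - 1) * stirling2 (n + 1) k) ^ 2 ∧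
      (∑ k ∈ Finset.Icc 1 (n + 1), (Nat.factorial (k - 1) * stirling2 (n + 1) k) ^ 2)
          < (n + 2) ^ (2 * n + 2)) ∧
    (∃ c₁ c₂ : ℝ, 0 < c₁ ∧ 0 < c₂ ∧ ∀ᶠ n : ℕ in Filter.atTop,
      c₁ * ((n : ℝ) * Real.log n)
          ≤ Real.logb 2 ((Finset.univ.filter fun S : Finset (Edge n) => A n S ≠ 0).card) ∧
      Real.logb 2 ((Finset.univ.filter fun S : Finset (Edge n) => A n S ≠ 0).card)
          ≤ c₂ * ((n : ℝ) * Real.log n)) := by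
  have hA' : ∀ n (T : Finset (Edge n)), ∑ S ∈ T.powerset, A n S = if complHasPM T then 0 else 1 :=
    fun n => sum_powerset_coeff (hA n)
  have key : ∀ n : ℕ, 1 < n →
      (Nat.factorial n) ^ 2
          ≤ (Finset.univ.filter fun S : Finset (Edge n) => A n S ≠ 0).card ∧
      (Finset.univ.filter fun S : Finset (Edge n) => A n S ≠ 0).card
          ≤ ∑ k ∈ Finset.Icc 1 (n + 1), (Nat.factorial (k - 1) * stirling2 (n + 1) k) ^ 2 ∧
      (∑ k ∈ Finset.Icc 1 (n + 1), (Nat.factorial (k - 1) * stirling2 (n + 1) k) ^ 2)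
          < (n + 2) ^ (2 * n + 2) := by
    intro n hn
    rw [sum_Icc_eq_sum_range_stirling2]
    refine ⟨factorial_sq_le_card_coeff_ne_zero (by omega) (hA' n), ?_,
      sum_factorial_mul_stirling2_sq_lt n⟩
    exact (Finset.card_le_card (Finset.monotone_filter_right _ fun S _ hS =>
      totallyOrdered_of_coeff_ne_zero (hA' n) hS)).trans (card_totallyOrdered_le n)
  exact ⟨key, eventually_logb_bounds fun n hn =>
    ⟨(key n hn).1, (key n hn).2.1.trans_lt (key n hn).2.2⟩⟩
end
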